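/- arXiv:1509.00988 — 3 statements merged into one kernel-verified Lean document; each statement's English description precedes it below -/
import Mathlib

section
/- Let C be a category of two-colored partitions. (a) If ∘⊗• ∉ C, then every block of every partition in C has at least two points. (b) If the four-block ∘•∘• ∉ C, then every block of every partition in C has at most two points. -/
noncomputable section
namespace CTCP

/-- Colors of points: `true` = white (∘), `false` = black (•). -/
abbrev Color := Bool

def white : Color := true
def black : Color := false

/-- A two-colored partition with `k` upper and `l` lower points.  The block
structure is recorded as a setoid on the disjoint union of the points. -/
structure TCP where
  k : ℕ
  l : ℕ
  upColor : Fin k → Color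
  lowColor : Fin l → Color
  rel : Setoid (Fin k ⊕ Fin l)

/-- The disjoint union of two equivalence relations. -/
def sumRel {α β : Type*} (r : Setoid α) (s : Setoid β) : (α ⊕ β) → (α ⊕ β) → Prop
  | .inl a, .inl b => r.r a b
  | .inr a, .inr b => s.r a b
  | _, _ => False

def sumSetoid {α β : Type*} (r : Setoid α) (s : Setoid β) : Setoid (α ⊕ β) where
  r := sumRel r s
  iseqv := by
    constructor
    · rintro (a | a)
      · exact r.iseqv.refl a
      · exact s.iseqv.refl a
    · rintro (a | a) (b | b) h
      · exact r.iseqv.symm h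
      · exact h.elim
      · exact h.elim
      · exact s.iseqv.symm h
    · rintro (a | a) (b | b) (c | c) h₁ h₂
      all_goals first
        | exact r.iseqv.trans h₁ h₂
        | exact s.iseqv.trans h₁ h₂
        | exact h₁.elim
        | exact h₂.elim

def splitPt (p q : TCP) :
    (Fin (p.k + q.k) ⊕ Fin (p.l + q.l)) → ((Fin p.k ⊕ Fin p.l) ⊕ (Fin q.k ⊕ Fin q.l))
  | .inl i => (finSumFinEquiv.symm i).elim (fun a => .inl (.inl a)) (fun b => .inr (.inl b))
  | .inr j => (finSumFinEquiv.symm j).elim (fun a => .inl (.inr a)) (fun b => .inr (.inr b))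

/-- Tensor product (horizontal concatenation) of two-colored partitions. -/
def tensor (p q : TCP) : TCP where
  k := p.k + q.k
  l := p.l + q.l
  upColor := fun i => (finSumFinEquiv.symm i).elim p.upColor q.upColor
  lowColor := fun j => (finSumFinEquiv.symm j).elim p.lowColor q.lowColor
  rel := Setoid.comap (splitPt p q) (sumSetoid p.rel q.rel)

def compEmbMid (q p : TCP) (h : q.l = p.k) :
    (Fin p.k ⊕ Fin p.l) → ((Fin q.k ⊕ Fin q.l) ⊕ Fin p.l)
  | .inl i => .inl (.inr (Fin.cast h.symm i))
  | .inr j => .inr j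

/-- The relation generating the blocks of the composition of `q` and `p`:
the blocks of `q` together with the blocks of `p`, glued along the middle row. -/
def compRel (q p : TCP) (h : q.l = p.k) :
    ((Fin q.k ⊕ Fin q.l) ⊕ Fin p.l) → ((Fin q.k ⊕ Fin q.l) ⊕ Fin p.l) → Prop :=
  fun t t' =>
    (∃ x y, q.rel.r x y ∧ t = .inl x ∧ t' = .inl y) ∨
    (∃ x y, p.rel.r x y ∧ t = compEmbMid q p h x ∧ t' = compEmbMid q p h y)

/-- Composition (vertical concatenation) of `q ∈ P(k,l)` with `p ∈ P(l,m)`: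
blocks are joined through the middle points, which are then deleted. -/
def comp (q p : TCP) (h : q.l = p.k) : TCP where
  k := q.k
  l := p.l
  upColor := q.upColor
  lowColor := p.lowColor
  rel := Setoid.comap
    (Sum.elim (fun i : Fin q.k => (Sum.inl (Sum.inl i) : (Fin q.k ⊕ Fin q.l) ⊕ Fin p.l))
      (fun j : Fin p.l => Sum.inr j))
    (Relation.EqvGen.setoid (compRel q p h))

/-- The colors of the lower row of `q` match the colors of the upper row of `p`. -/
def ColorsMatch (q p : TCP) (h : q.l = p.k) : Prop :=
  ∀ j : Fin q.l, q.lowColor j = p.upColor (Fin.cast h j)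

/-- Involution: reflection at the horizontal axis. -/
def invol (p : TCP) : TCP where
  k := p.l
  l := p.k
  upColor := p.lowColor
  lowColor := p.upColor
  rel := Setoid.comap Sum.swap p.rel

/-- Vertical reflection: reflection at the vertical axis. -/
def vref (p : TCP) : TCP where
  k := p.k
  l := p.l
  upColor := fun i => p.upColor i.rev
  lowColor := fun j => p.lowColor j.rev
  rel := Setoid.comap (Sum.map Fin.rev Fin.rev) p.rel

/-- Inversion of colors. -/
def cinv (p : TCP) : TCP where
  k := p.k
  l := p.l
  upColor := fun i => !(p.upColor i)
  lowColor := fun j => !(p.lowColor j)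
  rel := p.rel

/-- Verticolor reflection `p̃`: vertical reflection combined with color inversion. -/
def vcref (p : TCP) : TCP := cinv (vref p)

/-- Rotation of the leftmost upper point to the left end of the lower row
(inverting its color). -/
def rotULdown (p : TCP) (h : 0 < p.k) : TCP where
  k := p.k - 1
  l := p.l + 1
  upColor := fun i => p.upColor ⟨i.1 + 1, by have := i.2; omega⟩
  lowColor := fun j =>
    if hj : j.1 = 0 then !(p.upColor ⟨0, h⟩)
    else p.lowColor ⟨j.1 - 1, by have := j.2; omega⟩
  rel := Setoid.comap
    (Sum.elim
      (fun i : Fin (p.k - 1) => (Sum.inl ⟨i.1 + 1, by have := i.2; omega⟩ : Fin p.k ⊕ Fin p.l))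
      (fun j : Fin (p.l + 1) =>
        if hj : j.1 = 0 then Sum.inl ⟨0, h⟩
        else Sum.inr ⟨j.1 - 1, by have := j.2; omega⟩))
    p.rel

/-- Rotation of the rightmost upper point to the right end of the lower row
(inverting its color). -/
def rotURdown (p : TCP) (h : 0 < p.k) : TCP where
  k := p.k - 1
  l := p.l + 1
  upColor := fun i => p.upColor ⟨i.1, by have := i.2; omega⟩
  lowColor := fun j =>
    if hj : j.1 < p.l then p.lowColor ⟨j.1, hj⟩
    else !(p.upColor ⟨p.k - 1, by omega⟩)
  rel := Setoid.comap
    (Sum.elim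
      (fun i : Fin (p.k - 1) => (Sum.inl ⟨i.1, by have := i.2; omega⟩ : Fin p.k ⊕ Fin p.l))
      (fun j : Fin (p.l + 1) =>
        if hj : j.1 < p.l then Sum.inr ⟨j.1, hj⟩
        else Sum.inl ⟨p.k - 1, by omega⟩))
    p.rel

/-- Rotation of the leftmost lower point to the left end of the upper row
(inverting its color). -/
def rotULup (p : TCP) (h : 0 < p.l) : TCP where
  k := p.k + 1
  l := p.l - 1
  upColor := fun i =>
    if hi : i.1 = 0 then !(p.lowColor ⟨0, h⟩)
    else p.upColor ⟨i.1 - 1, by have := i.2; omega⟩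
  lowColor := fun j => p.lowColor ⟨j.1 + 1, by have := j.2; omega⟩
  rel := Setoid.comap
    (Sum.elim
      (fun i : Fin (p.k + 1) =>
        if hi : i.1 = 0 then (Sum.inr ⟨0, h⟩ : Fin p.k ⊕ Fin p.l)
        else Sum.inl ⟨i.1 - 1, by have := i.2; omega⟩)
      (fun j : Fin (p.l - 1) => Sum.inr ⟨j.1 + 1, by have := j.2; omega⟩))
    p.rel

/-- Rotation of the rightmost lower point to the right end of the upper row
(inverting its color). -/
def rotURup (p : TCP) (h : 0 < p.l) : TCP where
  k := p.k + 1
  l := p.l - 1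
  upColor := fun i =>
    if hi : i.1 < p.k then p.upColor ⟨i.1, hi⟩
    else !(p.lowColor ⟨p.l - 1, by omega⟩)
  lowColor := fun j => p.lowColor ⟨j.1, by have := j.2; omega⟩
  rel := Setoid.comap
    (Sum.elim
      (fun i : Fin (p.k + 1) =>
        if hi : i.1 < p.k then (Sum.inl ⟨i.1, hi⟩ : Fin p.k ⊕ Fin p.l)
        else Sum.inr ⟨p.l - 1, by omega⟩)
      (fun j : Fin (p.l - 1) => Sum.inr ⟨j.1, by have := j.2; omega⟩))
    p.rel

/-- `p'` is obtained from `p` by rotating an outermost point of one row to the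
corresponding end of the other row, inverting its color. -/
def IsRotationOf (p' p : TCP) : Prop :=
  (∃ h : 0 < p.k, p' = rotULdown p h) ∨ (∃ h : 0 < p.k, p' = rotURdown p h) ∨
  (∃ h : 0 < p.l, p' = rotULup p h) ∨ (∃ h : 0 < p.l, p' = rotURup p h)

/-- A partition with no upper points, given by colors and block labels. -/
def mkLower (n : ℕ) (color : Fin n → Color) (lbl : Fin n → ℕ) : TCP where
  k := 0
  l := n
  upColor := Fin.elim0
  lowColor := color
  rel := Setoid.ker (Sum.elim Fin.elim0 lbl)

/-- The identity partition of color `c`. -/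
def idPart (c : Color) : TCP where
  k := 1
  l := 1
  upColor := fun _ => c
  lowColor := fun _ => c
  rel := ⊤

/-- The pair partition on two lower points of colors `c₁`, `c₂`. -/
def pairLower (c₁ c₂ : Color) : TCP := mkLower 2 ![c₁, c₂] (fun _ => 0)

/-- The singleton of color `c`. -/
def singl (c : Color) : TCP := mkLower 1 (fun _ => c) (fun _ => 0)

/-- `bPart s` : one block on `s` white lower points (`bPart 0` is the empty partition). -/
def bPart (s : ℕ) : TCP := mkLower s (fun _ => white) (fun _ => 0)

/-- One block on four lower points with the given colors. -/
def fourBlock (c₁ c₂ c₃ c₄ : Color) : TCP := mkLower 4 ![c₁, c₂, c₃, c₄] (fun _ => 0)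

/-- The four-block ∘•∘•. -/
def fourWBWB : TCP := fourBlock white black white black

/-- The four-block ∘∘••. -/
def fourWWBB : TCP := fourBlock white white black black

/-- The empty partition. -/
def emptyPart : TCP := mkLower 0 Fin.elim0 Fin.elim0

/-- The partition ∘⊗• (a white and a black singleton). -/
def singPair : TCP := tensor (singl white) (singl black)

/-- The partition ∘∘⊗••. -/
def wwbb : TCP := tensor (pairLower white white) (pairLower black black)

/-- The crossing partition `X` on four white points: first upper point connected to the
second lower point, second upper point connected to the first lower point. -/
def crossPart : TCP where
  k := 2
  l := 2
  upColor := fun _ => white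
  lowColor := fun _ => white
  rel := Setoid.ker (Sum.elim (fun i : Fin 2 => (i.1 : ℕ)) (fun j : Fin 2 => 1 - j.1))

/-- `n`-fold tensor power. -/
def tensorPow (p : TCP) : ℕ → TCP
  | 0 => emptyPart
  | n + 1 => tensor (tensorPow p n) p

/-- The partition `p_d`: from left to right, `d` white singletons, a white point, `d` black
singletons and a black point, the two non-singleton points forming a pair block. -/
def pPart (d : ℕ) : TCP :=
  mkLower (2 * d + 2) (fun j => decide (j.1 ≤ d))
    (fun j => if j.1 = d ∨ j.1 = 2 * d + 1 then 0 else j.1 + 1)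

/-- The partition `p′_r`: from left to right, `r+1` white singletons, a black point, `r−1`
black singletons and a black point, the black non-singleton points forming a pair block;
for `r = 0` the middle consists of one white singleton instead. -/
def pPrime (r : ℕ) : TCP :=
  if r = 0 then
    mkLower 4 ![white, black, white, black]
      (fun j => if j.1 = 1 ∨ j.1 = 3 then 0 else j.1 + 1)
  else
    mkLower (2 * r + 2) (fun j => decide (j.1 ≤ r))
      (fun j => if j.1 = r + 1 ∨ j.1 = 2 * r + 1 then 0 else j.1 + 1)

/-- A category of two-colored partitions: a class of two-colored partitions closed under
tensor products, composition (when defined) and involution, containing both bicolored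
pair partitions and both identity partitions. -/
structure IsCategory (C : Set TCP) : Prop where
  tensor_mem : ∀ p ∈ C, ∀ q ∈ C, tensor p q ∈ C
  comp_mem : ∀ q ∈ C, ∀ p ∈ C, ∀ h : q.l = p.k, ColorsMatch q p h → comp q p h ∈ C
  invol_mem : ∀ p ∈ C, invol p ∈ C
  idw_mem : idPart white ∈ C
  idb_mem : idPart black ∈ C
  pairwb_mem : pairLower white black ∈ C
  pairbw_mem : pairLower black white ∈ C

/-- The smallest category of partitions containing `S`. -/
def generated (S : Set TCP) : Set TCP :=
  {p | ∀ C : Set TCP, IsCategory C → S ⊆ C → p ∈ C}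

/-- `c(p)` : (white lower points + black upper points) − (black lower points + white upper
points). -/
def cval (p : TCP) : ℤ :=
  ((Nat.card {j : Fin p.l // p.lowColor j = white} +
      Nat.card {i : Fin p.k // p.upColor i = black} : ℕ) : ℤ) -
    ((Nat.card {j : Fin p.l // p.lowColor j = black} +
      Nat.card {i : Fin p.k // p.upColor i = white} : ℕ) : ℤ)

/-- Position of a point on the line obtained by rotating all upper points down to the
left of the lower row. -/
def linePos (p : TCP) : (Fin p.k ⊕ Fin p.l) → ℕ :=
  Sum.elim (fun i => p.k - 1 - i.1) (fun j => p.k + j.1)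

/-- A partition is noncrossing if its strings can be drawn without crossings. -/
def Noncrossing (p : TCP) : Prop :=
  ∀ a b x y : Fin p.k ⊕ Fin p.l,
    linePos p a < linePos p b → linePos p b < linePos p x → linePos p x < linePos p y →
    p.rel.r a x → p.rel.r b y → p.rel.r a b

/-- The number of points in the block of the point `x`. -/
def blockSize (p : TCP) (x : Fin p.k ⊕ Fin p.l) : ℕ := Nat.card {y // p.rel.r x y}

/-- The partition obtained from `p` by rotating all upper points down, so that it has no
upper points. -/
def toLine (p : TCP) : TCP where
  k := 0
  l := p.k + p.l
  upColor := Fin.elim0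
  lowColor := fun j =>
    if hj : j.1 < p.k then !(p.upColor ⟨p.k - 1 - j.1, by omega⟩)
    else p.lowColor ⟨j.1 - p.k, by have := j.2; omega⟩
  rel := Setoid.comap
    (Sum.elim (fun i : Fin 0 => (Fin.elim0 i : Fin p.k ⊕ Fin p.l))
      (fun j : Fin (p.k + p.l) =>
        if hj : j.1 < p.k then Sum.inl ⟨p.k - 1 - j.1, by omega⟩
        else Sum.inr ⟨j.1 - p.k, by have := j.2; omega⟩))
    p.rel

def eraseLowRel (p : TCP) (j : ℕ) (hj : j + 1 < p.l) :
    (Fin p.k ⊕ Fin p.l) → (Fin p.k ⊕ Fin p.l) → Prop :=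
  fun x y => p.rel.r x y ∨ (x = Sum.inr ⟨j, by omega⟩ ∧ y = Sum.inr ⟨j + 1, hj⟩)

/-- Erasing the `j`-th and `(j+1)`-th lower points of `p`, first joining their blocks. -/
def eraseLowerPair (p : TCP) (j : ℕ) (hj : j + 1 < p.l) : TCP where
  k := p.k
  l := p.l - 2
  upColor := p.upColor
  lowColor := fun m =>
    if hm : m.1 < j then p.lowColor ⟨m.1, by omega⟩
    else p.lowColor ⟨m.1 + 2, by have := m.2; omega⟩
  rel := Setoid.comap
    (Sum.elim (fun i : Fin p.k => (Sum.inl i : Fin p.k ⊕ Fin p.l))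
      (fun m : Fin (p.l - 2) =>
        if hm : m.1 < j then Sum.inr ⟨m.1, by omega⟩
        else Sum.inr ⟨m.1 + 2, by have := m.2; omega⟩))
    (Relation.EqvGen.setoid (eraseLowRel p j hj))

def eraseUpRel (p : TCP) (j : ℕ) (hj : j + 1 < p.k) :
    (Fin p.k ⊕ Fin p.l) → (Fin p.k ⊕ Fin p.l) → Prop :=
  fun x y => p.rel.r x y ∨ (x = Sum.inl ⟨j, by omega⟩ ∧ y = Sum.inl ⟨j + 1, hj⟩)

/-- Erasing the `j`-th and `(j+1)`-th upper points of `p`, first joining their blocks. -/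
def eraseUpperPair (p : TCP) (j : ℕ) (hj : j + 1 < p.k) : TCP where
  k := p.k - 2
  l := p.l
  upColor := fun m =>
    if hm : m.1 < j then p.upColor ⟨m.1, by omega⟩
    else p.upColor ⟨m.1 + 2, by have := m.2; omega⟩
  lowColor := p.lowColor
  rel := Setoid.comap
    (Sum.elim
      (fun m : Fin (p.k - 2) =>
        if hm : m.1 < j then (Sum.inl ⟨m.1, by omega⟩ : Fin p.k ⊕ Fin p.l)
        else Sum.inl ⟨m.1 + 2, by have := m.2; omega⟩)
      (fun i : Fin p.l => Sum.inr i))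
    (Relation.EqvGen.setoid (eraseUpRel p j hj))

/-- `p₁ ⊗ p₂ ∈ C` is in nest decomposed form, with the first point of `p₂` colored `x`
and the last point of `p₂` colored `y` (and those two points in the same block). -/
def InNDF (C : Set TCP) (x y : Color) (p₁ p₂ : TCP) : Prop :=
  tensor p₁ p₂ ∈ C ∧ Noncrossing (tensor p₁ p₂) ∧ p₁.k = 0 ∧ p₂.k = 0 ∧ 0 < p₁.l ∧
    ∃ h : 2 ≤ p₂.l,
      p₂.lowColor ⟨0, by omega⟩ = x ∧ p₂.lowColor ⟨p₂.l - 1, by omega⟩ = y ∧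
      p₂.rel.r (Sum.inr ⟨0, by omega⟩) (Sum.inr ⟨p₂.l - 1, by omega⟩)

/-- `K^C(x,y)`: the set of values `c(p₁)` over nest decomposed forms `p₁ ⊗ p₂ ∈ C` whose
outer block starts with color `x` and ends with color `y`. -/
def Kset (C : Set TCP) (x y : Color) : Set ℤ :=
  {n | ∃ p₁ p₂, InNDF C x y p₁ p₂ ∧ cval p₁ = n}

/-- The degree of reflection `k(C)`. -/
def kdeg (C : Set TCP) : ℕ := sInf {n : ℕ | 0 < n ∧ ∃ p ∈ C, cval p = (n : ℤ)}

/-- The local parameter `d(C)`. -/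
def ddeg (C : Set TCP) : ℕ := sInf {n : ℕ | 0 < n ∧ (n : ℤ) ∈ Kset C white black}

/-- The local parameter `r(C) = min {t ≥ 1 | t ∈ K^C(•,•)} − 1`. -/
def rdeg (C : Set TCP) : ℕ := sInf {t : ℕ | 1 ≤ t ∧ (t : ℤ) ∈ Kset C black black} - 1

/-- `C` is globally colorized if it contains `∘∘ ⊗ ••`. -/
def GloballyColorized (C : Set TCP) : Prop := wwbb ∈ C

def CaseO (C : Set TCP) : Prop := singPair ∉ C ∧ fourWBWB ∉ C
def CaseB (C : Set TCP) : Prop := singPair ∈ C ∧ fourWBWB ∉ C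
def CaseH (C : Set TCP) : Prop := singPair ∉ C ∧ fourWBWB ∈ C
def CaseS (C : Set TCP) : Prop := singPair ∈ C ∧ fourWBWB ∈ C

/-! Non-colored partitions. -/

/-- A non-colored partition with `k` upper and `l` lower points. -/
structure NCP where
  k : ℕ
  l : ℕ
  rel : Setoid (Fin k ⊕ Fin l)

namespace NCP

def splitPt (p q : NCP) :
    (Fin (p.k + q.k) ⊕ Fin (p.l + q.l)) → ((Fin p.k ⊕ Fin p.l) ⊕ (Fin q.k ⊕ Fin q.l))
  | .inl i => (finSumFinEquiv.symm i).elim (fun a => .inl (.inl a)) (fun b => .inr (.inl b))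
  | .inr j => (finSumFinEquiv.symm j).elim (fun a => .inl (.inr a)) (fun b => .inr (.inr b))

def tensor (p q : NCP) : NCP where
  k := p.k + q.k
  l := p.l + q.l
  rel := Setoid.comap (splitPt p q) (sumSetoid p.rel q.rel)

def compEmbMid (q p : NCP) (h : q.l = p.k) :
    (Fin p.k ⊕ Fin p.l) → ((Fin q.k ⊕ Fin q.l) ⊕ Fin p.l)
  | .inl i => .inl (.inr (Fin.cast h.symm i))
  | .inr j => .inr j

def compRel (q p : NCP) (h : q.l = p.k) :
    ((Fin q.k ⊕ Fin q.l) ⊕ Fin p.l) → ((Fin q.k ⊕ Fin q.l) ⊕ Fin p.l) → Prop :=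
  fun t t' =>
    (∃ x y, q.rel.r x y ∧ t = .inl x ∧ t' = .inl y) ∨
    (∃ x y, p.rel.r x y ∧ t = compEmbMid q p h x ∧ t' = compEmbMid q p h y)

def comp (q p : NCP) (h : q.l = p.k) : NCP where
  k := q.k
  l := p.l
  rel := Setoid.comap
    (Sum.elim (fun i : Fin q.k => (Sum.inl (Sum.inl i) : (Fin q.k ⊕ Fin q.l) ⊕ Fin p.l))
      (fun j : Fin p.l => Sum.inr j))
    (Relation.EqvGen.setoid (compRel q p h))

def invol (p : NCP) : NCP where
  k := p.l
  l := p.k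
  rel := Setoid.comap Sum.swap p.rel

/-- The non-colored identity partition. -/
def idN : NCP := ⟨1, 1, ⊤⟩

/-- The non-colored pair partition on two lower points. -/
def pairN : NCP := ⟨0, 2, ⊤⟩

end NCP

/-- A category of non-colored partitions. -/
structure IsCategoryN (D : Set NCP) : Prop where
  tensor_mem : ∀ p ∈ D, ∀ q ∈ D, NCP.tensor p q ∈ D
  comp_mem : ∀ q ∈ D, ∀ p ∈ D, ∀ h : q.l = p.k, NCP.comp q p h ∈ D
  invol_mem : ∀ p ∈ D, NCP.invol p ∈ D
  id_mem : NCP.idN ∈ D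
  pair_mem : NCP.pairN ∈ D

/-- The map `Ψ` forgetting the colors of a two-colored partition. -/
def forget (p : TCP) : NCP := ⟨p.k, p.l, p.rel⟩

/-! Partitions described by labels: two points lie in the same block iff their labels agree. -/

/-- The partition with `k` upper and `l` lower points whose colors are given by `u`, `d` and
whose blocks are the level sets of the labels `fu`, `fl`. -/
def labelled (k l : ℕ) (u d : ℕ → Color) {X : Type} (fu fl : ℕ → X) : TCP where
  k := k
  l := l
  upColor := fun i => u i
  lowColor := fun j => d j
  rel := Setoid.ker (Sum.elim (fun i : Fin k => fu i) (fun j : Fin l => fl j))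

/-- Prepend a value to a sequence. -/
def consSeq {X : Type} (a : X) (f : ℕ → X) : ℕ → X
  | 0 => a
  | n + 1 => f n

theorem consSeq_eq_ite {X : Type} (a : X) (f : ℕ → X) (n : ℕ) :
    consSeq a f n = if n = 0 then a else f (n - 1) := by
  cases n <;> rfl

theorem labelled_congr {k l : ℕ} {u d u' d' : ℕ → Color} {X Y : Type} {fu fl : ℕ → X}
    {gu gl : ℕ → Y} (hu : ∀ i < k, u i = u' i) (hd : ∀ j < l, d j = d' j)
    (huu : ∀ i < k, ∀ i' < k, fu i = fu i' ↔ gu i = gu i')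
    (hul : ∀ i < k, ∀ j < l, fu i = fl j ↔ gu i = gl j)
    (hll : ∀ j < l, ∀ j' < l, fl j = fl j' ↔ gl j = gl j') :
    labelled k l u d fu fl = labelled k l u' d' gu gl := by
  unfold labelled
  congr 1
  · funext i; exact hu i i.2
  · funext j; exact hd j j.2
  · ext x y
    rcases x with i | i <;> rcases y with j | j <;>
      simp only [Setoid.ker_def, Sum.elim_inl, Sum.elim_inr]
    · exact huu i i.2 j j.2
    · exact hul i i.2 j j.2
    · rw [eq_comm, hul j j.2 i i.2, eq_comm]
    · exact hll i i.2 j j.2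

theorem exists_eq_labelled (p : TCP) : ∃ (u d : ℕ → Color) (X : Type) (fu fl : ℕ → X),
    p = labelled p.k p.l u d fu fl ∧
    (∀ i j, p.rel.r (Sum.inl i) (Sum.inl j) ↔ fu i = fu j) ∧
    (∀ i j, p.rel.r (Sum.inl i) (Sum.inr j) ↔ fu i = fl j) ∧
    (∀ i j, p.rel.r (Sum.inr i) (Sum.inr j) ↔ fl i = fl j) := by
  have key : ∀ x y, (Quotient.mk p.rel x = Quotient.mk p.rel y) ↔ p.rel.r x y :=
    fun x y => Quotient.eq
  refine ⟨fun i => if h : i < p.k then p.upColor ⟨i, h⟩ else false,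
    fun i => if h : i < p.l then p.lowColor ⟨i, h⟩ else false, Option (Quotient p.rel),
    fun i => if h : i < p.k then some (Quotient.mk p.rel (Sum.inl ⟨i, h⟩)) else none,
    fun i => if h : i < p.l then some (Quotient.mk p.rel (Sum.inr ⟨i, h⟩)) else none,
    ?_, ?_, ?_, ?_⟩
  · obtain ⟨k, l, u, d, r⟩ := p
    unfold labelled
    congr 1
    · funext i; simp
    · funext i; simp
    · ext x y
      rcases x with i | i <;> rcases y with j | j <;>
        simp only [Setoid.ker_def, Sum.elim_inl, Sum.elim_inr, Fin.is_lt, dite_true, Fin.eta,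
          Option.some.injEq, key]
  all_goals
    intro i j
    simp only [Fin.is_lt, dite_true, Fin.eta, Option.some.injEq, key]

theorem invol_labelled (k l : ℕ) (u d : ℕ → Color) {X : Type} (fu fl : ℕ → X) :
    invol (labelled k l u d fu fl) = labelled l k d u fl fu := by
  unfold labelled invol
  congr 1
  ext x y
  rcases x with i | i <;> rcases y with j | j <;> rfl

/-- Labels of a horizontal concatenation, the first row having `k` points. -/
def appendLabel (k : ℕ) {X Y : Type} (f : ℕ → X) (g : ℕ → Y) (i : ℕ) : X ⊕ Y :=
  if i < k then Sum.inl (f i) else Sum.inr (g (i - k))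

/-- Horizontal concatenation of color sequences, the first one having length `k`. -/
def appendColor (k : ℕ) (u v : ℕ → Color) (i : ℕ) : Color :=
  if i < k then u i else v (i - k)

theorem tensor_labelled (k l k' l' : ℕ) (u d u' d' : ℕ → Color) {X Y : Type}
    (fu fl : ℕ → X) (gu gl : ℕ → Y) :
    tensor (labelled k l u d fu fl) (labelled k' l' u' d' gu gl) =
      labelled (k + k') (l + l') (appendColor k u u') (appendColor l d d')
        (appendLabel k fu gu) (appendLabel l fl gl) := by
  unfold labelled tensor
  congr 1
  · funext (i : Fin (k + k'))
    induction i using Fin.addCases <;> simp [appendColor]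
  · funext (j : Fin (l + l'))
    induction j using Fin.addCases <;> simp [appendColor]
  · ext (x : Fin (k + k') ⊕ Fin (l + l')) (y : Fin (k + k') ⊕ Fin (l + l'))
    rw [Setoid.comap_rel, Setoid.ker_def]
    rcases x with i | i <;> rcases y with j | j <;>
      induction i using Fin.addCases <;> induction j using Fin.addCases <;>
      simp [appendLabel, splitPt] <;> first | rfl | exact fun h => h.elim

/-- Labels of a vertical concatenation: labels are identified along the `m` middle points. -/
def GlueLabel (m : ℕ) {X Y : Type} (fm : ℕ → X) (gm : ℕ → Y) : Type :=
  Quot (fun a b : X ⊕ Y => ∃ j < m, a = Sum.inl (fm j) ∧ b = Sum.inr (gm j))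

/-- The glued label of a label of the upper partition. -/
def glueUp (m : ℕ) {X Y : Type} (fm : ℕ → X) (gm : ℕ → Y) (x : X) : GlueLabel m fm gm :=
  Quot.mk _ (Sum.inl x)

/-- The glued label of a label of the lower partition. -/
def glueLow (m : ℕ) {X Y : Type} (fm : ℕ → X) (gm : ℕ → Y) (y : Y) : GlueLabel m fm gm :=
  Quot.mk _ (Sum.inr y)

theorem glue_mid {m : ℕ} {X Y : Type} {fm : ℕ → X} {gm : ℕ → Y} {j : ℕ} (hj : j < m) :
    glueUp m fm gm (fm j) = glueLow m fm gm (gm j) :=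
  Quot.sound ⟨j, hj, rfl, rfl⟩

theorem glue_lift {m : ℕ} {X Y : Type} {fm : ℕ → X} {gm : ℕ → Y} {Z : Type*} (φ : X → Z)
    (ψ : Y → Z) (h : ∀ j < m, φ (fm j) = ψ (gm j)) :
    ∃ F : GlueLabel m fm gm → Z, (∀ x, F (glueUp m fm gm x) = φ x) ∧
      ∀ y, F (glueLow m fm gm y) = ψ y := by
  refine ⟨Quot.lift (Sum.elim φ ψ) ?_, fun _ => rfl, fun _ => rfl⟩
  rintro _ _ ⟨j, hj, rfl, rfl⟩
  exact h j hj

theorem comp_labelled (k m l : ℕ) (u c c' d : ℕ → Color) {X Y : Type}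
    (fu fm : ℕ → X) (gm gl : ℕ → Y) :
    comp (labelled k m u c fu fm) (labelled m l c' d gm gl) rfl =
      labelled k l u d (fun i => glueUp m fm gm (fu i)) (fun j => glueLow m fm gm (gl j)) := by
  let q := labelled k m u c fu fm
  let p := labelled m l c' d gm gl
  let E : Setoid ((Fin k ⊕ Fin m) ⊕ Fin l) := Relation.EqvGen.setoid (compRel q p rfl)
  let lq : Fin k ⊕ Fin m → X := Sum.elim (fun i => fu i) (fun j => fm j)
  let lp : Fin m ⊕ Fin l → Y := Sum.elim (fun i => gm i) (fun j => gl j)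
  let e : Fin m ⊕ Fin l → (Fin k ⊕ Fin m) ⊕ Fin l := compEmbMid q p rfl
  have eq_q : ∀ x y, lq x = lq y → E (Sum.inl x) (Sum.inl y) := fun x y h =>
    Relation.EqvGen.rel _ _ (Or.inl ⟨x, y, h, rfl, rfl⟩)
  have eq_p : ∀ x y, lp x = lp y → E (e x) (e y) := fun x y h =>
    Relation.EqvGen.rel _ _ (Or.inr ⟨x, y, h, rfl, rfl⟩)
  let L : (Fin k ⊕ Fin m) ⊕ Fin l → GlueLabel m fm gm :=
    Sum.elim (fun x => glueUp m fm gm (lq x)) (fun j => glueLow m fm gm (gl j))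
  have L_e : ∀ x, L (e x) = glueLow m fm gm (lp x) := by
    rintro (j | j)
    · exact glue_mid j.2
    · rfl
  have sound : ∀ s t, E s t → L s = L t := by
    intro s t h
    induction h with
    | rel s t h =>
      rcases h with ⟨x, y, h, rfl, rfl⟩ | ⟨x, y, h, rfl, rfl⟩
      · exact congrArg (glueUp m fm gm) h
      · exact (L_e x).trans ((congrArg (glueLow m fm gm) h).trans (L_e y).symm)
    | refl => rfl
    | symm _ _ _ ih => exact ih.symm
    | trans _ _ _ _ _ ih₁ ih₂ => exact ih₁.trans ih₂
  obtain ⟨F, F_up, F_low⟩ := glue_lift (m := m) (fm := fm) (gm := gm)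
    (fun x => {t | ∃ s, lq s = x ∧ E t (Sum.inl s)})
    (fun y => {t | ∃ s, lp s = y ∧ E t (e s)}) (by
      intro j hj
      ext t
      constructor
      · rintro ⟨s, hs, hst⟩
        exact ⟨Sum.inl ⟨j, hj⟩, rfl, E.trans hst (eq_q s (Sum.inr ⟨j, hj⟩) hs)⟩
      · rintro ⟨s, hs, hst⟩
        exact ⟨Sum.inr ⟨j, hj⟩, rfl, E.trans hst (eq_p s (Sum.inl ⟨j, hj⟩) hs)⟩)
  have complete : ∀ s t, L s = L t → E s t := by
    have mem : ∀ s t, t ∈ F (L s) ↔ E t s := by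
      rintro (s | s) t
      · change t ∈ F (glueUp m fm gm (lq s)) ↔ _
        rw [F_up]
        exact ⟨fun ⟨s', h, h'⟩ => E.trans h' (eq_q s' s h), fun h => ⟨s, rfl, h⟩⟩
      · change t ∈ F (glueLow m fm gm (lp (Sum.inr s))) ↔ _
        rw [F_low]
        exact ⟨fun ⟨s', h, h'⟩ => E.trans h' (eq_p s' (Sum.inr s) h),
          fun h => ⟨Sum.inr s, rfl, h⟩⟩
    intro s t h
    exact (mem t s).1 (h ▸ (mem s s).2 (E.refl s))
  unfold comp labelled
  congr 1
  ext x y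
  rw [Setoid.comap_rel, Setoid.ker_def]
  rcases x with i | i <;> rcases y with j | j
  · exact ⟨sound _ _, complete (Sum.inl (Sum.inl i)) (Sum.inl (Sum.inl j))⟩
  · exact ⟨sound _ _, complete (Sum.inl (Sum.inl i)) (Sum.inr j)⟩
  · exact ⟨sound _ _, complete (Sum.inr i) (Sum.inl (Sum.inl j))⟩
  · exact ⟨sound _ _, complete (Sum.inr i) (Sum.inr j)⟩

theorem comp_labelled_mem {C : Set TCP} (hC : IsCategory C) {k m l : ℕ} {u c c' d : ℕ → Color}
    {X Y : Type} {fu fm : ℕ → X} {gm gl : ℕ → Y} (hq : labelled k m u c fu fm ∈ C)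
    (hp : labelled m l c' d gm gl ∈ C) (h : ∀ j < m, c j = c' j) :
    labelled k l u d (fun i => glueUp m fm gm (fu i)) (fun j => glueLow m fm gm (gl j)) ∈ C := by
  rw [← comp_labelled k m l u c c' d]
  exact hC.comp_mem _ hq _ hp rfl fun j => h j j.2

theorem invol_labelled_mem {C : Set TCP} (hC : IsCategory C) {k l : ℕ} {u d : ℕ → Color}
    {X : Type} {fu fl : ℕ → X} (h : labelled k l u d fu fl ∈ C) :
    labelled l k d u fl fu ∈ C :=
  invol_labelled k l u d fu fl ▸ hC.invol_mem _ h

theorem tensor_labelled_mem {C : Set TCP} (hC : IsCategory C) {k l k' l' : ℕ}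
    {u d u' d' : ℕ → Color} {X Y : Type} {fu fl : ℕ → X} {gu gl : ℕ → Y}
    (hp : labelled k l u d fu fl ∈ C) (hq : labelled k' l' u' d' gu gl ∈ C) :
    labelled (k + k') (l + l') (appendColor k u u') (appendColor l d d')
      (appendLabel k fu gu) (appendLabel l fl gl) ∈ C :=
  tensor_labelled k l k' l' u d u' d' fu fl gu gl ▸ hC.tensor_mem _ hp _ hq

theorem idPart_eq_labelled (c : Color) :
    idPart c = labelled 1 1 (fun _ => c) (fun _ => c) (fun _ => ()) (fun _ => ()) := by
  unfold idPart labelled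
  congr 1
  ext x y
  simp only [Setoid.ker_def, iff_true]
  trivial

theorem mkLower_eq_labelled {n : ℕ} {color : Fin n → Color} {lbl : Fin n → ℕ}
    (u d : ℕ → Color) {X : Type} (fu fl : ℕ → X) (hd : ∀ j, color j = d j)
    (hl : ∀ i j, lbl i = lbl j ↔ fl i = fl j) :
    mkLower n color lbl = labelled 0 n u d fu fl := by
  unfold mkLower labelled
  congr 1
  · funext i; exact i.elim0
  · funext j; exact hd j
  · ext x y
    rcases x with i | i
    · exact i.elim0
    rcases y with j | j
    · exact j.elim0
    exact hl i j

theorem pairLower_mem {C : Set TCP} (hC : IsCategory C) (c : Color) :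
    labelled 0 2 (fun _ => c) (consSeq c fun _ => !c) (fun _ => ()) (fun _ => ()) ∈ C := by
  have h : pairLower c (!c) ∈ C := by
    cases c
    · exact hC.pairbw_mem
    · exact hC.pairwb_mem
  rwa [pairLower, mkLower_eq_labelled (fun _ => c) (consSeq c fun _ => !c) (fun _ => ())
    (fun _ => ()) (by intro j; fin_cases j <;> rfl) (by simp)] at h

theorem idPart_mem {C : Set TCP} (hC : IsCategory C) (c : Color) :
    labelled 1 1 (fun _ => c) (fun _ => c) (fun _ => ()) (fun _ => ()) ∈ C := by
  rw [← idPart_eq_labelled]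
  cases c
  · exact hC.idb_mem
  · exact hC.idw_mem

/-- The identity on any color sequence belongs to every category. -/
theorem identity_mem {C : Set TCP} (hC : IsCategory C) (k : ℕ) (u : ℕ → Color) :
    labelled k k u u (fun i => i) (fun i => i) ∈ C := by
  induction k with
  | zero =>
    have h := pairLower_mem hC white
    have h' := comp_labelled_mem hC h (invol_labelled_mem hC h) fun _ _ => rfl
    rwa [labelled_congr (u' := u) (d' := u) (gu := fun i => i) (gl := fun i => i)] at h' <;>
      intro i hi <;> omega
  | succ k ih =>
    have h := tensor_labelled_mem hC ih (idPart_mem hC (u k))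
    rwa [labelled_congr (u' := u) (d' := u) (gu := fun i => i) (gl := fun i => i)] at h <;>
      grind [appendColor, appendLabel]

/-- Moving the leftmost upper point to the left end of the lower row. -/
theorem rotate_left_down {C : Set TCP} (hC : IsCategory C) {k l : ℕ} {u d : ℕ → Color}
    {X : Type} {fu fl : ℕ → X} (h : labelled (k + 1) l u d fu fl ∈ C) :
    labelled k (l + 1) (fun i => u (i + 1)) (consSeq (!u 0) d) (fun i => fu (i + 1))
      (consSeq (fu 0) fl) ∈ C := by
  have hq : labelled k (k + 2) (fun i => u (i + 1)) (consSeq (!u 0) u)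
      some (consSeq none (consSeq none some)) ∈ C := by
    have h := tensor_labelled_mem hC (pairLower_mem hC (!u 0))
      (identity_mem hC k fun i => u (i + 1))
    rw [Nat.zero_add, Nat.add_comm 2] at h
    rwa [labelled_congr] at h <;> grind [appendColor, appendLabel, consSeq_eq_ite]
  have hp : labelled (k + 2) (l + 1) (consSeq (!u 0) u) (consSeq (!u 0) d)
      (consSeq none fun i => some (fu i)) (consSeq none fun i => some (fl i)) ∈ C := by
    have h := tensor_labelled_mem hC (idPart_mem hC (!u 0)) h
    rw [Nat.add_comm 1, Nat.add_comm 1] at h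
    rwa [labelled_congr] at h <;> grind [appendColor, appendLabel, consSeq_eq_ite]
  have hc := comp_labelled_mem hC hq hp fun _ _ => rfl
  obtain ⟨F, -, F_low⟩ := glue_lift (m := k + 2) (fm := consSeq none (consSeq none some))
    (gm := consSeq none fun i => some (fu i))
    (fun x : Option ℕ => x.elim (fu 0) fun i => fu (i + 1)) (fun y : Option X => y.getD (fu 0))
    (by rintro (_ | _ | j) _ <;> rfl)
  set g : X → GlueLabel (k + 2) (consSeq none (consSeq none some))
    (consSeq none fun i => some (fu i)) := fun x => glueLow _ _ _ (some x) with hg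
  have g_inj : Function.Injective g := fun x y hxy => by
    simpa [hg, F_low] using congrArg F hxy
  have up : ∀ i < k, glueUp (k + 2) (consSeq none (consSeq none some))
      (consSeq none fun i => some (fu i)) (some i) = g (fu (i + 1)) := fun i hi =>
    glue_mid (fm := consSeq none (consSeq none some))
      (gm := consSeq none fun i => some (fu i)) (j := i + 2) (by omega)
  have low : ∀ j, glueLow (k + 2) (consSeq none (consSeq none some))
      (consSeq none fun i => some (fu i)) (consSeq none (fun i => some (fl i)) j) =
        g (consSeq (fu 0) fl j) := by
    rintro (_ | j)
    · exact (glue_mid (fm := consSeq none (consSeq none some))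
        (gm := consSeq none fun i => some (fu i)) (j := 0) (by omega)).symm.trans
        (glue_mid (fm := consSeq none (consSeq none some))
        (gm := consSeq none fun i => some (fu i)) (j := 1) (by omega))
    · rfl
  rwa [labelled_congr] at hc
  · simp
  · simp
  · intro i hi j hj
    rw [up i hi, up j hj, g_inj.eq_iff]
  · intro i hi j hj
    rw [up i hi, low j, g_inj.eq_iff]
  · intro i hi j hj
    rw [low i, low j, g_inj.eq_iff]

/-- Moving the rightmost upper point to the right end of the lower row. -/
theorem rotate_right_down {C : Set TCP} (hC : IsCategory C) {k l : ℕ} {u d : ℕ → Color}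
    {X : Type} {fu fl : ℕ → X} (h : labelled (k + 1) l u d fu fl ∈ C) :
    labelled k (l + 1) u (fun j => if j < l then d j else !u k) fu
      (fun j => if j < l then fl j else fu k) ∈ C := by
  let c : ℕ → Color := fun i => if i < k + 1 then u i else !u k
  let fm : ℕ → Option ℕ := fun i => if i < k then some i else none
  let gm : ℕ → Option X := fun i => if i < k + 1 then some (fu i) else none
  have hq : labelled k (k + 2) u c some fm ∈ C := by
    have h := tensor_labelled_mem hC (identity_mem hC k u) (pairLower_mem hC (u k))
    rw [Nat.add_zero] at h
    rwa [labelled_congr] at h <;> grind [appendColor, appendLabel, consSeq_eq_ite]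
  have hp : labelled (k + 2) (l + 1) c (fun j => if j < l then d j else !u k) gm
      (fun j => if j < l then some (fl j) else none) ∈ C := by
    have h := tensor_labelled_mem hC h (idPart_mem hC (!u k))
    rwa [labelled_congr] at h <;> grind [appendColor, appendLabel]
  have hc := comp_labelled_mem hC hq hp fun _ _ => rfl
  obtain ⟨F, -, F_low⟩ := glue_lift (m := k + 2) (fm := fm) (gm := gm)
    (fun x => x.elim (fu k) fu) (fun y => y.getD (fu k)) (by
      intro j hj
      by_cases h₁ : j < k
      · simp [fm, gm, h₁, h₁.le]
      · by_cases h₂ : j < k + 1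
        · obtain rfl : j = k := by omega
          simp [fm, gm]
        · simp [fm, gm, h₁, show ¬ j ≤ k by omega])
  set g : X → GlueLabel (k + 2) fm gm := fun x => glueLow _ _ _ (some x) with hg
  have g_inj : Function.Injective g := fun x y hxy => by
    simpa [hg, F_low] using congrArg F hxy
  have up : ∀ i < k, glueUp (k + 2) fm gm (some i) = g (fu i) := fun i hi => by
    have h₁ := glue_mid (fm := fm) (gm := gm) (j := i) (by omega : i < k + 2)
    simp only [fm, gm, hi, Nat.lt_succ_of_lt hi, if_true] at h₁
    exact h₁
  have low : ∀ j, glueLow (k + 2) fm gm (if j < l then some (fl j) else none) =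
      g (if j < l then fl j else fu k) := by
    intro j
    split_ifs
    · rfl
    · have h₁ := glue_mid (fm := fm) (gm := gm) (j := k) (by omega : k < k + 2)
      have h₂ := glue_mid (fm := fm) (gm := gm) (j := k + 1) (by omega : k + 1 < k + 2)
      simp only [fm, gm, lt_irrefl, if_false, Nat.lt_succ_self, if_true,
        show ¬ k + 1 < k by omega] at h₁ h₂
      exact h₂.symm.trans h₁
  rwa [labelled_congr] at hc
  · simp
  · simp
  · intro i hi j hj
    rw [up i hi, up j hj, g_inj.eq_iff]
  · intro i hi j hj
    rw [up i hi, low j, g_inj.eq_iff]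
  · intro i hi j hj
    rw [low i, low j, g_inj.eq_iff]

/-- Moving the leftmost lower point to the left end of the upper row. -/
theorem rotate_left_up {C : Set TCP} (hC : IsCategory C) {k l : ℕ} {u d : ℕ → Color}
    {X : Type} {fu fl : ℕ → X} (h : labelled k (l + 1) u d fu fl ∈ C) :
    labelled (k + 1) l (consSeq (!d 0) u) (fun i => d (i + 1)) (consSeq (fl 0) fu)
      (fun i => fl (i + 1)) ∈ C :=
  invol_labelled_mem hC (rotate_left_down hC (invol_labelled_mem hC h))

/-- Moving the `j` leftmost lower points to the upper row. -/
theorem exists_rotate_left_up {C : Set TCP} (hC : IsCategory C) {k l : ℕ} (j : ℕ)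
    {u d : ℕ → Color} {X : Type} {fu fl : ℕ → X} (h : labelled k (l + j) u d fu fl ∈ C) :
    ∃ u', labelled (k + j) l u' (fun i => d (i + j))
      (fun i => if i < j then fl (j - 1 - i) else fu (i - j)) (fun i => fl (i + j)) ∈ C := by
  induction j generalizing l with
  | zero => exact ⟨u, by simpa using h⟩
  | succ j ih =>
    obtain ⟨u', h'⟩ := ih (l := l + 1) (by rwa [show l + 1 + j = l + (j + 1) by omega])
    refine ⟨_, labelled_congr (fun _ _ => rfl) ?_ ?_ ?_ ?_ ▸ rotate_left_up hC h'⟩ <;>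
      grind [consSeq_eq_ite]

/-- Moving the `n` rightmost lower points to the upper row. -/
theorem exists_rotate_right_up {C : Set TCP} (hC : IsCategory C) {k l : ℕ} (n : ℕ)
    {u d : ℕ → Color} {X : Type} {fu fl : ℕ → X} (h : labelled k (l + n) u d fu fl ∈ C) :
    ∃ u', labelled (k + n) l u' d
      (fun i => if i < k then fu i else fl (l + n - 1 - (i - k))) fl ∈ C := by
  induction n generalizing l with
  | zero =>
    refine ⟨u, ?_⟩
    rwa [labelled_congr] at h <;> grind
  | succ n ih =>
    obtain ⟨u', h'⟩ := ih (l := l + 1) (by rwa [show l + 1 + n = l + (n + 1) by omega])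
    have h'' := invol_labelled_mem hC (rotate_right_down hC (invol_labelled_mem hC h'))
    refine ⟨_, labelled_congr (fun _ _ => rfl) ?_ ?_ ?_ ?_ ▸ h''⟩ <;> grind

/-- The composition of the reflection of a partition with the partition itself. -/
theorem comp_invol_self_mem {C : Set TCP} (hC : IsCategory C) {k l : ℕ} {u d : ℕ → Color}
    {X : Type} {fu fl : ℕ → X} (h : labelled k l u d fu fl ∈ C) :
    labelled l l d d (fun i => glueUp k fu fu (fl i)) (fun j => glueLow k fu fu (fl j)) ∈ C :=
  comp_labelled_mem hC (invol_labelled_mem hC h) h fun _ _ => rfl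

theorem singPair_eq_labelled {u d : ℕ → Color} {X : Type} {fu fl : ℕ → X} (h₀ : d 0 = white)
    (h₁ : d 1 = black) (hne : fl 0 ≠ fl 1) : singPair = labelled 0 2 u d fu fl := by
  have hs : ∀ c, singl c = labelled 0 1 (fun _ => c) (fun _ => c) (fun _ => ()) (fun _ => ()) :=
    fun c => mkLower_eq_labelled _ _ _ _ (by simp) (by simp)
  rw [singPair, hs, hs, tensor_labelled]
  apply labelled_congr
  · grind
  · intro j hj
    interval_cases j <;> simp [appendColor, h₀, h₁]
  · grind
  · grind
  · intro i hi j hj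
    interval_cases i <;> interval_cases j <;> simp [appendLabel, hne, hne.symm]

/-- A partition whose lower row is a singleton block generates `∘⊗•`. -/
theorem singPair_mem_of_row {C : Set TCP} (hC : IsCategory C) {k : ℕ} {u d : ℕ → Color}
    {X : Type} {fu fl : ℕ → X} (h : labelled k 1 u d fu fl ∈ C) (hup : ∀ i < k, fu i ≠ fl 0) :
    singPair ∈ C := by
  have hc := comp_invol_self_mem hC h
  obtain ⟨F, F_up, F_low⟩ := glue_lift (m := k) (fm := fu) (gm := fu) (fun x => x = fl 0)
    (fun _ => False) (fun j hj => eq_false (hup j hj))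
  have hne : glueUp k fu fu (fl 0) ≠ glueLow k fu fu (fl 0) := fun he => by
    simpa [F_up, F_low] using congrArg F he
  cases h₀ : d 0
  · have hl := rotate_left_down hC hc
    rwa [← singPair_eq_labelled] at hl
    · simp [consSeq, h₀, white]
    · exact h₀
    · exact hne
  · have hr := rotate_right_down hC hc
    rwa [← singPair_eq_labelled] at hr
    · exact h₀
    · simp [h₀, black]
    · exact hne.symm

/-- A partition with a lower singleton block generates `∘⊗•`. -/
theorem singPair_mem {C : Set TCP} (hC : IsCategory C) {k l j : ℕ} {u d : ℕ → Color} {X : Type}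
    {fu fl : ℕ → X} (h : labelled k l u d fu fl ∈ C) (hj : j < l)
    (hup : ∀ i < k, fu i ≠ fl j) (hlow : ∀ i < l, i ≠ j → fl i ≠ fl j) : singPair ∈ C := by
  obtain ⟨n, rfl⟩ : ∃ n, l = 1 + n + j := ⟨l - 1 - j, by omega⟩
  obtain ⟨u₁, h₁⟩ := exists_rotate_left_up hC j h
  obtain ⟨u₂, h₂⟩ := exists_rotate_right_up hC n h₁
  refine singPair_mem_of_row hC h₂ fun i hi => ?_
  simp only [Nat.zero_add]
  split_ifs
  · exact hlow _ (by omega) (by omega)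
  · exact hup _ (by omega)
  · exact hlow _ (by omega) (by omega)

theorem fourWBWB_eq_labelled {u d : ℕ → Color} {X : Type} {fu fl : ℕ → X} (h₀ : d 0 = white)
    (h₁ : d 1 = black) (h₂ : d 2 = white) (h₃ : d 3 = black) (hl : ∀ j < 4, fl j = fl 0) :
    fourWBWB = labelled 0 4 u d fu fl := by
  refine mkLower_eq_labelled _ _ _ _ (fun j => ?_) (fun i j => ?_)
  · fin_cases j
    exacts [h₀.symm, h₁.symm, h₂.symm, h₃.symm]
  · simp [hl i i.2, hl j j.2]

/-- A block meeting the upper row and containing two lower points of different colors, which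
form the whole lower row, generates `∘•∘•`. -/
theorem fourWBWB_mem_of_row {C : Set TCP} (hC : IsCategory C) {k i : ℕ} {u d : ℕ → Color}
    {X : Type} {fu fl : ℕ → X} (h : labelled k 2 u d fu fl ∈ C) (hd : d 0 = !d 1) (hi : i < k)
    (hi₀ : fu i = fl 0) (h₁ : fl 1 = fl 0) : fourWBWB ∈ C := by
  have hc := rotate_left_down hC (rotate_left_down hC (comp_invol_self_mem hC h))
  have hm : glueUp k fu fu (fl 0) = glueLow k fu fu (fl 0) := hi₀ ▸ glue_mid hi
  cases hb : d 1
  · rwa [← fourWBWB_eq_labelled] at hc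
    · simp [consSeq, hb, white]
    · simp [consSeq, hb, hd, black]
    · simp [consSeq, hb, hd, white]
    · simp [consSeq, hb, black]
    · intro j hj
      interval_cases j <;> simp [consSeq, h₁, hm]
  · have hr := rotate_right_down hC (rotate_left_up hC hc)
    rwa [← fourWBWB_eq_labelled] at hr
    · simp [consSeq, hb, hd, white]
    · simp [consSeq, hb, hd, black]
    · simp [consSeq, hb, white]
    · simp [consSeq, hb, black]
    · intro j hj
      interval_cases j <;> simp [consSeq, h₁, hm]

/-- A block containing the first lower point, another lower point and an upper point
generates `∘•∘•`. -/
theorem fourWBWB_mem_of_first {C : Set TCP} (hC : IsCategory C) {k l i j : ℕ}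
    {u d : ℕ → Color} {X : Type} {fu fl : ℕ → X} (h : labelled k l u d fu fl ∈ C) (hi : i < k)
    (hj : j < l) (hj₀ : 0 < j) (hil : fu i = fl 0) (hjl : fl j = fl 0) : fourWBWB ∈ C := by
  obtain ⟨n, rfl⟩ : ∃ n, l = n + 1 := ⟨l - 1, by omega⟩
  have hm : glueUp k fu fu (fl 0) = glueLow k fu fu (fl 0) := hil ▸ glue_mid hi
  have hs := rotate_left_down hC (comp_invol_self_mem hC h)
  rw [show n + 1 + 1 = 2 + n by omega] at hs
  obtain ⟨u', h'⟩ := exists_rotate_right_up hC n hs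
  refine fourWBWB_mem_of_row hC (i := j - 1) h' ?_ (by omega) ?_ ?_
  · simp [consSeq]
  · simp [consSeq, show j - 1 < n by omega, Nat.sub_add_cancel hj₀, hjl]
  · simp [consSeq, hm]

/-- A block containing two lower points and an upper point generates `∘•∘•`. -/
theorem fourWBWB_mem_of_up {C : Set TCP} (hC : IsCategory C) {k l i a b : ℕ}
    {u d : ℕ → Color} {X : Type} {fu fl : ℕ → X} (h : labelled k l u d fu fl ∈ C) (hi : i < k)
    (ha : a < l) (hb : b < l) (hab : a ≠ b) (hia : fu i = fl a) (hib : fu i = fl b) :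
    fourWBWB ∈ C := by
  wlog hlt : a < b generalizing a b
  · exact this hb ha hab.symm hib hia (by omega)
  obtain ⟨n, rfl⟩ : ∃ n, l = n + a := ⟨l - a, by omega⟩
  obtain ⟨u', h'⟩ := exists_rotate_left_up hC a h
  refine fourWBWB_mem_of_first hC (i := i + a) (j := b - a) h' (by omega) (by omega) (by omega)
    ?_ ?_
  · simp [hia]
  · simp [Nat.sub_add_cancel hlt.le, ← hia, hib]

/-- A block containing three lower points generates `∘•∘•`. -/
theorem fourWBWB_mem_of_low {C : Set TCP} (hC : IsCategory C) {k l a b c : ℕ}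
    {u d : ℕ → Color} {X : Type} {fu fl : ℕ → X} (h : labelled k l u d fu fl ∈ C)
    (ha : a < l) (hb : b < l) (hc : c < l) (hab : a ≠ b) (hac : a ≠ c) (hbc : b ≠ c)
    (hlab : fl a = fl b) (hlac : fl a = fl c) : fourWBWB ∈ C := by
  wlog hle : a < b ∧ a < c generalizing a b c
  · rcases lt_or_gt_of_ne hab with h₁ | h₁ <;> rcases lt_or_gt_of_ne hbc with h₂ | h₂
    · exact absurd ⟨h₁, h₁.trans h₂⟩ hle
    · exact this hc ha hb hac.symm hbc.symm hab hlac.symm (hlac.symm.trans hlab) (by omega)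
    · exact this hb ha hc hab.symm hbc hac hlab.symm (hlab.symm.trans hlac) (by omega)
    · exact this hc ha hb hac.symm hbc.symm hab hlac.symm (hlac.symm.trans hlab) (by omega)
  obtain ⟨n, rfl⟩ : ∃ n, l = n + (a + 1) := ⟨l - (a + 1), by omega⟩
  obtain ⟨u', h'⟩ := exists_rotate_left_up hC (a + 1) h
  refine fourWBWB_mem_of_up hC (i := 0) (a := b - (a + 1)) (b := c - (a + 1)) h' (by omega)
    (by omega) (by omega) (by omega) ?_ ?_
  · simp [Nat.sub_add_cancel (show a + 1 ≤ b by omega), hlab]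
  · simp [Nat.sub_add_cancel (show a + 1 ≤ c by omega), hlac]

/-- (a) If `∘⊗• ∉ C`, all blocks of partitions in `C` have length at least two.
(b) If `∘•∘• ∉ C`, all blocks of partitions in `C` have length at most two. -/
theorem stmt_3 (C : Set TCP) (hC : IsCategory C) :
    (singPair ∉ C → ∀ p ∈ C, ∀ x : Fin p.k ⊕ Fin p.l, 2 ≤ blockSize p x) ∧
    (fourWBWB ∉ C → ∀ p ∈ C, ∀ x : Fin p.k ⊕ Fin p.l, blockSize p x ≤ 2) := by
  constructor
  · intro hs p hp x
    by_contra hlt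
    obtain ⟨u, d, X, fu, fl, he, huu, hul, hll⟩ := exists_eq_labelled p
    have hM : labelled p.k p.l u d fu fl ∈ C := he ▸ hp
    have hsub : Subsingleton {y // p.rel.r x y} := by
      rw [← Finite.card_le_one_iff_subsingleton]
      exact Nat.le_of_lt_succ (not_le.mp hlt)
    have huniq : ∀ y, p.rel.r x y → y = x := fun y hy =>
      congrArg Subtype.val (Subsingleton.elim (⟨y, hy⟩ : {y // p.rel.r x y}) ⟨x, p.rel.refl x⟩)
    rcases x with i | j
    · refine hs (singPair_mem hC (invol_labelled_mem hC hM) i.2 (fun a ha hl => ?_)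
        fun a ha hne hl => ?_)
      · exact Sum.inr_ne_inl (huniq (Sum.inr ⟨a, ha⟩) ((hul i ⟨a, ha⟩).2 hl.symm))
      · have := huniq (Sum.inl ⟨a, ha⟩) ((huu i ⟨a, ha⟩).2 hl.symm)
        exact hne (congrArg Fin.val (Sum.inl_injective this))
    · refine hs (singPair_mem hC hM j.2 (fun a ha hl => ?_) fun a ha hne hl => ?_)
      · exact Sum.inl_ne_inr
          (huniq (Sum.inl ⟨a, ha⟩) (p.rel.symm ((hul ⟨a, ha⟩ j).2 hl)))
      · have := huniq (Sum.inr ⟨a, ha⟩) ((hll j ⟨a, ha⟩).2 hl.symm)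
        exact hne (congrArg Fin.val (Sum.inr_injective this))
  · intro hs p hp x
    by_contra hlt
    obtain ⟨u, d, X, fu, fl, he, huu, hul, hll⟩ := exists_eq_labelled p
    have hM : labelled p.k p.l u d fu fl ∈ C := he ▸ hp
    have hM' := invol_labelled_mem hC hM
    have hcard : 2 < Nat.card {y // p.rel.r x y} := not_le.mp hlt
    classical
    rw [Nat.card_eq_fintype_card, Fintype.two_lt_card_iff] at hcard
    obtain ⟨⟨a, ha⟩, ⟨b, hb⟩, ⟨c, hc⟩, hab, hac, hbc⟩ := hcard
    have rab : p.rel.r a b := p.rel.trans (p.rel.symm ha) hb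
    have rac : p.rel.r a c := p.rel.trans (p.rel.symm ha) hc
    have rbc : p.rel.r b c := p.rel.trans (p.rel.symm hb) hc
    have rba := p.rel.symm rab
    have rca := p.rel.symm rac
    have rcb := p.rel.symm rbc
    simp only [ne_eq, Subtype.mk.injEq] at hab hac hbc
    apply hs
    rcases a with a | a <;> rcases b with b | b <;> rcases c with c | c <;>
      simp only [Sum.inl.injEq, Sum.inr.injEq, Fin.ext_iff] at hab hac hbc
    · exact fourWBWB_mem_of_low hC hM' a.2 b.2 c.2 hab hac hbc ((huu _ _).1 rab) ((huu _ _).1 rac)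
    · exact fourWBWB_mem_of_up hC hM' c.2 a.2 b.2 hab ((hul _ _).1 rac).symm
        ((hul _ _).1 rbc).symm
    · exact fourWBWB_mem_of_up hC hM' b.2 a.2 c.2 hac ((hul _ _).1 rab).symm
        ((hul _ _).1 rcb).symm
    · exact fourWBWB_mem_of_up hC hM a.2 b.2 c.2 hbc ((hul _ _).1 rab) ((hul _ _).1 rac)
    · exact fourWBWB_mem_of_up hC hM' a.2 b.2 c.2 hbc ((hul _ _).1 rba).symm
        ((hul _ _).1 rca).symm
    · exact fourWBWB_mem_of_up hC hM b.2 a.2 c.2 hac ((hul _ _).1 rba) ((hul _ _).1 rbc)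
    · exact fourWBWB_mem_of_up hC hM c.2 a.2 b.2 hab ((hul _ _).1 rca) ((hul _ _).1 rcb)
    · exact fourWBWB_mem_of_low hC hM a.2 b.2 c.2 hab hac hbc ((hll _ _).1 rab) ((hll _ _).1 rac)

end CTCP
end
end

section
/- Let C be a category of two-colored partitions and let k := k(C) ∈ ℕ₀. Then c(p) ∈ kℤ for every partition p ∈ C. -/
noncomputable section
namespace CTCP

theorem card_color_finSum {m n : ℕ} (f : Fin m → Color) (g : Fin n → Color) (c : Color) :
    Nat.card {i : Fin (m + n) // (finSumFinEquiv.symm i).elim f g = c} =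
      Nat.card {i // f i = c} + Nat.card {j // g j = c} := by
  rw [← Nat.card_sum]
  exact Nat.card_congr
    ((finSumFinEquiv.symm.subtypeEquiv fun _ => Iff.rfl).trans
      (Equiv.subtypeSum (p := fun x => x.elim f g = c)))

theorem cval_tensor (p q : TCP) : cval (tensor p q) = cval p + cval q := by
  simp only [cval, tensor, card_color_finSum]
  push_cast
  ring

theorem cval_invol (p : TCP) : cval (invol p) = -cval p := by
  simp only [cval, invol]
  push_cast
  ring

/-- The values of `c` on a category form a subgroup of `ℤ`. -/
def cvalSubgroup (C : Set TCP) (hC : IsCategory C) : AddSubgroup ℤ where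
  carrier := cval '' C
  zero_mem' := ⟨tensor (idPart white) (invol (idPart white)),
    hC.tensor_mem _ hC.idw_mem _ (hC.invol_mem _ hC.idw_mem),
    by rw [cval_tensor, cval_invol, add_neg_cancel]⟩
  add_mem' := by
    rintro _ _ ⟨p, hp, rfl⟩ ⟨q, hq, rfl⟩
    exact ⟨tensor p q, hC.tensor_mem p hp q hq, cval_tensor p q⟩
  neg_mem' := by
    rintro _ ⟨p, hp, rfl⟩
    exact ⟨invol p, hC.invol_mem p hp, cval_invol p⟩

/-- A subgroup of `ℤ` consists of multiples of its least positive element. -/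
theorem sInf_pos_dvd_of_mem (H : AddSubgroup ℤ) {a : ℤ} (ha : a ∈ H) :
    ((sInf {n : ℕ | 0 < n ∧ (n : ℤ) ∈ H} : ℕ) : ℤ) ∣ a := by
  set S := {n : ℕ | 0 < n ∧ (n : ℤ) ∈ H}
  rcases eq_or_ne a 0 with rfl | ha0
  · exact dvd_zero _
  have hne : S.Nonempty := ⟨a.natAbs, Int.natAbs_pos.2 ha0, by
    rcases Int.natAbs_eq a with h | h
    · rwa [← h]
    · rw [← neg_eq_iff_eq_neg.2 h]
      exact H.neg_mem ha⟩
  obtain ⟨hpos, hmem⟩ := Nat.sInf_mem hne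
  set k := sInf S
  have hk : (0 : ℤ) < k := by exact_mod_cast hpos
  have hr : a % k ∈ H := by
    rw [Int.emod_def, mul_comm, ← smul_eq_mul]
    exact H.sub_mem ha (H.zsmul_mem hmem _)
  have hr0 := Int.emod_nonneg a hk.ne'
  have hlt := Int.emod_lt_of_pos a hk
  rw [Int.dvd_iff_emod_eq_zero]
  by_contra hr1
  have hle : k ≤ (a % k).toNat :=
    Nat.sInf_le ⟨by omega, by rwa [Int.toNat_of_nonneg hr0]⟩
  omega

/-- For every partition `p` in a category `C`, `c(p)` lies in `k(C)·ℤ`. -/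
theorem stmt_5 (C : Set TCP) (hC : IsCategory C) :
    ∀ p ∈ C, (kdeg C : ℤ) ∣ cval p := by
  intro p hp
  exact sInf_pos_dvd_of_mem (cvalSubgroup C hC) ⟨p, hp, rfl⟩

end CTCP
end
end

section
/- Let C ⊆ NC°• be a category of noncrossing two-colored partitions. Then K^C(∘,•) = dℤ where d = d(C). Moreover, if k(C) ≠ 0, then d(C) ≠ 0 and d(C) divides k(C). -/
noncomputable section
namespace CTCP

/-- Block labels of the points of a partition, from labels of the upper and lower positions. -/
def label {k l : ℕ} (s t : ℕ → ℕ) : Fin k ⊕ Fin l → ℕ :=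
  Sum.elim (fun i => s i) (fun j => t j)

/-- `p` has `k` upper and `l` lower points, its colors are `u` and `d`, and its blocks are the
fibers of the labels `s` (upper row) and `t` (lower row). -/
structure Models (p : TCP) (k l : ℕ) (u d : ℕ → Color) (s t : ℕ → ℕ) : Prop where
  hk : p.k = k
  hl : p.l = l
  up : ∀ i : Fin p.k, p.upColor i = u i
  low : ∀ j : Fin p.l, p.lowColor j = d j
  rel : ∀ x y, p.rel.r x y ↔ label s t x = label s t y

/-- `C` contains a partition described by the given colors and labels. -/
def HasModel (C : Set TCP) (k l : ℕ) (u d : ℕ → Color) (s t : ℕ → ℕ) : Prop :=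
  ∃ p ∈ C, Models p k l u d s t

/-- The function equal to `f` below `n` and to the shift of `g` from `n` on. -/
def splice {α : Type*} (n : ℕ) (f g : ℕ → α) : ℕ → α :=
  fun i => if i < n then f i else g (i - n)

/-- The increasing enumeration of the positions other than `j` and `j + 1`. -/
def skip (j i : ℕ) : ℕ := if i < j then i else i + 2

/-- Identification of the label `b` with the label `a`. -/
def merge (a b x : ℕ) : ℕ := if x = b then a else x

theorem Models.congr {p : TCP} {k l : ℕ} {u d u' d' : ℕ → Color} {s t s' t' : ℕ → ℕ}
    (h : Models p k l u d s t) (hu : ∀ i < k, u i = u' i) (hd : ∀ i < l, d i = d' i)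
    (hss : ∀ i < k, ∀ j < k, (s i = s j ↔ s' i = s' j))
    (hst : ∀ i < k, ∀ j < l, (s i = t j ↔ s' i = t' j))
    (htt : ∀ i < l, ∀ j < l, (t i = t j ↔ t' i = t' j)) : Models p k l u' d' s' t' := by
  obtain ⟨rfl, rfl, h3, h4, h5⟩ := h
  refine ⟨rfl, rfl, fun i => (h3 i).trans (hu i i.2), fun i => (h4 i).trans (hd i i.2), ?_⟩
  rintro (x | x) (y | y) <;> rw [h5] <;> simp only [label, Sum.elim_inl, Sum.elim_inr]
  · exact hss x x.2 y y.2
  · exact hst x x.2 y y.2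
  · rw [eq_comm, hst y y.2 x x.2, eq_comm]
  · exact htt x x.2 y y.2

theorem HasModel.congr {C : Set TCP} {k l k' l' : ℕ} {u d u' d' : ℕ → Color} {s t s' t' : ℕ → ℕ}
    (h : HasModel C k l u d s t) (hk : k = k') (hl : l = l')
    (hu : ∀ i < k, u i = u' i) (hd : ∀ i < l, d i = d' i)
    (hss : ∀ i < k, ∀ j < k, (s i = s j ↔ s' i = s' j))
    (hst : ∀ i < k, ∀ j < l, (s i = t j ↔ s' i = t' j))
    (htt : ∀ i < l, ∀ j < l, (t i = t j ↔ t' i = t' j)) : HasModel C k' l' u' d' s' t' := by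
  subst hk hl
  obtain ⟨p, hp, hm⟩ := h
  exact ⟨p, hp, hm.congr hu hd hss hst htt⟩

theorem Models.unique {p p' : TCP} {k l : ℕ} {u d : ℕ → Color} {s t : ℕ → ℕ}
    (h : Models p k l u d s t) (h' : Models p' k l u d s t) : p = p' := by
  obtain ⟨k₁, l₁, u₁, d₁, r₁⟩ := p
  obtain ⟨k₂, l₂, u₂, d₂, r₂⟩ := p'
  obtain ⟨h1, h2, h3, h4, h5⟩ := h
  obtain ⟨h1', h2', h3', h4', h5'⟩ := h'
  simp only at h1 h2 h1' h2'
  subst h1 h2 h1' h2'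
  simp only at h3 h4 h5 h3' h4' h5'
  have e1 : u₁ = u₂ := funext fun i => (h3 i).trans (h3' i).symm
  have e2 : d₁ = d₂ := funext fun i => (h4 i).trans (h4' i).symm
  have e3 : r₁ = r₂ := Setoid.ext fun x y => (h5 x y).trans (h5' x y).symm
  rw [e1, e2, e3]

theorem exists_models (p : TCP) : ∃ u d s t, Models p p.k p.l u d s t := by
  obtain ⟨f, hf⟩ := exists_injective_nat (Quotient p.rel)
  refine ⟨fun i => if h : i < p.k then p.upColor ⟨i, h⟩ else white,
    fun i => if h : i < p.l then p.lowColor ⟨i, h⟩ else white,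
    fun i => if h : i < p.k then f (Quotient.mk _ (.inl ⟨i, h⟩)) else 0,
    fun i => if h : i < p.l then f (Quotient.mk _ (.inr ⟨i, h⟩)) else 0,
    rfl, rfl, fun i => by simp, fun i => by simp, ?_⟩
  intro x y
  have key : ∀ x : Fin p.k ⊕ Fin p.l,
      label (fun i => if h : i < p.k then f (Quotient.mk _ (.inl ⟨i, h⟩)) else 0)
        (fun i => if h : i < p.l then f (Quotient.mk _ (.inr ⟨i, h⟩)) else 0) x =
      f (Quotient.mk _ x) := by
    rintro (x | x) <;> simp [label]
  rw [key, key, hf.eq_iff]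
  exact Quotient.eq.symm

theorem Models.tensor {p q : TCP} {k l k' l' : ℕ} {u d u' d' : ℕ → Color} {s t s' t' : ℕ → ℕ}
    (h : Models p k l u d s t) (h' : Models q k' l' u' d' s' t') :
    Models (tensor p q) (k + k') (l + l') (splice k u u') (splice l d d')
      (splice k (fun i => 2 * s i) (fun i => 2 * s' i + 1))
      (splice l (fun i => 2 * t i) (fun i => 2 * t' i + 1)) := by
  obtain ⟨rfl, rfl, h3, h4, h5⟩ := h
  obtain ⟨rfl, rfl, h3', h4', h5'⟩ := h'
  refine ⟨rfl, rfl, ?_, ?_, ?_⟩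
  · intro i
    change Fin (p.k + q.k) at i
    induction i using Fin.addCases <;> simp [CTCP.tensor, splice, h3, h3']
  · intro i
    change Fin (p.l + q.l) at i
    induction i using Fin.addCases <;> simp [CTCP.tensor, splice, h4, h4']
  · have key : ∀ x : Fin (p.k + q.k) ⊕ Fin (p.l + q.l),
        label (splice p.k (fun i => 2 * s i) (fun i => 2 * s' i + 1))
          (splice p.l (fun i => 2 * t i) (fun i => 2 * t' i + 1)) x =
        Sum.elim (fun a => 2 * label s t a) (fun b => 2 * label s' t' b + 1) (splitPt p q x) := by
      rintro (i | i) <;> induction i using Fin.addCases <;> simp [splice, splitPt, label]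
    intro x y
    change sumRel p.rel q.rel (splitPt p q x) (splitPt p q y) ↔ _
    erw [key x, key y]
    rcases splitPt p q x with a | a <;> rcases splitPt p q y with b | b <;>
      simp only [sumRel, Sum.elim_inl, Sum.elim_inr]
    · rw [h5]; omega
    · exact iff_of_false not_false (by omega)
    · exact iff_of_false not_false (by omega)
    · rw [h5']; omega

theorem HasModel.tensor {C : Set TCP} (hC : IsCategory C) {k l k' l' : ℕ}
    {u d u' d' : ℕ → Color} {s t s' t' : ℕ → ℕ}
    (h : HasModel C k l u d s t) (h' : HasModel C k' l' u' d' s' t') :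
    HasModel C (k + k') (l + l') (splice k u u') (splice l d d')
      (splice k (fun i => 2 * s i) (fun i => 2 * s' i + 1))
      (splice l (fun i => 2 * t i) (fun i => 2 * t' i + 1)) := by
  obtain ⟨p, hp, hm⟩ := h
  obtain ⟨q, hq, hm'⟩ := h'
  exact ⟨_, hC.tensor_mem p hp q hq, hm.tensor hm'⟩

theorem HasModel.invol {C : Set TCP} (hC : IsCategory C) {k l : ℕ}
    {u d : ℕ → Color} {s t : ℕ → ℕ} (h : HasModel C k l u d s t) :
    HasModel C l k d u t s := by
  obtain ⟨p, hp, rfl, rfl, h3, h4, h5⟩ := h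
  refine ⟨_, hC.invol_mem p hp, rfl, rfl, h4, h3, ?_⟩
  have key : ∀ x : Fin p.l ⊕ Fin p.k, label t s x = label s t x.swap := by
    rintro (x | x) <;> rfl
  intro x y
  erw [key x, key y]
  exact h5 _ _

theorem IsCategory.pairLower_mem {C : Set TCP} (hC : IsCategory C) {a b : Color} (h : b = !a) :
    pairLower a b ∈ C := by
  subst h
  cases a
  · exact hC.pairbw_mem
  · exact hC.pairwb_mem

theorem models_pairLower (u d : ℕ → Color) (s : ℕ → ℕ) :
    Models (pairLower (d 0) (d 1)) 0 2 u d s (fun _ => 0) := by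
  refine ⟨rfl, rfl, fun i => i.elim0, ?_, ?_⟩
  · intro i
    change Fin 2 at i
    fin_cases i <;> rfl
  · intro x y
    rcases x with x | x
    · exact x.elim0
    rcases y with y | y
    · exact y.elim0
    exact ⟨fun _ => rfl, fun _ => rfl⟩

theorem hasModel_idPart {C : Set TCP} (hC : IsCategory C) (c : Color) :
    HasModel C 1 1 (fun _ => c) (fun _ => c) (fun _ => 0) (fun _ => 0) := by
  refine ⟨idPart c, ?_, rfl, rfl, fun _ => rfl, fun _ => rfl, ?_⟩
  · cases c
    · exact hC.idb_mem
    · exact hC.idw_mem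
  · rintro (x | x) (y | y) <;> exact ⟨fun _ => rfl, fun _ => trivial⟩

theorem hasModel_empty {C : Set TCP} (hC : IsCategory C) (u d : ℕ → Color) (s t : ℕ → ℕ) :
    HasModel C 0 0 u d s t := by
  refine ⟨_, hC.comp_mem _ hC.pairwb_mem _ (hC.invol_mem _ hC.pairwb_mem) rfl (fun _ => rfl),
    rfl, rfl, fun i => i.elim0, fun i => i.elim0, ?_⟩
  rintro (x | x) <;> exact x.elim0

theorem hasModel_identity {C : Set TCP} (hC : IsCategory C) (d : ℕ → Color) (n : ℕ) :
    HasModel C n n d d id id := by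
  induction n with
  | zero => exact hasModel_empty hC _ _ _ _
  | succ n ih =>
    refine (ih.tensor hC (hasModel_idPart hC (d n))).congr rfl rfl ?_ ?_ ?_ ?_ ?_ <;>
      grind [splice]

theorem hasModel_cap {C : Set TCP} (hC : IsCategory C) (d : ℕ → Color) {j l : ℕ} (hj : j ≤ l)
    (hd : d (j + 1) = !d j) :
    HasModel C (l + 2) l d (fun i => d (skip j i)) (fun a => if a = j + 1 then j else a)
      (skip j) := by
  have hcap : HasModel C 2 0 (fun i => d (j + i)) d (fun _ => 0) (fun _ => 0) :=
    HasModel.invol hC ⟨_, hC.pairLower_mem hd, models_pairLower d (fun i => d (j + i)) _⟩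
  refine (((hasModel_identity hC d j).tensor hC hcap).tensor hC
    (hasModel_identity hC (fun i => d (j + 2 + i)) (l - j))).congr
    (by omega) (by omega) ?_ ?_ ?_ ?_ ?_ <;> grind [splice, skip]

theorem HasModel.contract {C : Set TCP} (hC : IsCategory C) {k l : ℕ}
    {u d : ℕ → Color} {s t : ℕ → ℕ} (h : HasModel C k (l + 2) u d s t) {j : ℕ} (hj : j ≤ l)
    (hd : d (j + 1) = !d j) :
    HasModel C k l u (fun i => d (skip j i)) (fun i => merge (t j) (t (j + 1)) (s i))
      (fun i => merge (t j) (t (j + 1)) (t (skip j i))) := by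
  obtain ⟨q, hq, rfl, h2, h3, h4, h5⟩ := h
  obtain ⟨p, hp, g1, rfl, g3, g4, g5⟩ := hasModel_cap hC d hj hd
  have hqp : q.l = p.k := h2.trans g1.symm
  refine ⟨_, hC.comp_mem q hq p hp hqp
    fun i => (h4 i).trans (g3 (Fin.cast hqp i)).symm, rfl, rfl, h3, g4, ?_⟩
  -- the label of a point of the glued diagram
  let F : (Fin q.k ⊕ Fin q.l) ⊕ Fin p.l → ℕ := fun x => merge (t j) (t (j + 1))
    (Sum.elim (label s t) (fun i : Fin p.l => t (skip j i)) x)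
  have hskip : ∀ i : Fin p.l, skip j i < q.l := by
    intro i; have := i.2; grind [skip]
  have hp_low : ∀ i : Fin p.l, p.rel.r (Sum.inl ⟨skip j i, by have := hskip i; omega⟩)
      (Sum.inr i) := by
    intro i
    rw [g5]
    simp only [label, Sum.elim_inl, Sum.elim_inr]
    grind [skip]
  have hlow : ∀ i : Fin p.l, Relation.EqvGen (compRel q p hqp)
      (.inl (.inr ⟨skip j i, hskip i⟩)) (.inr i) := fun i =>
    .rel _ _ (.inr ⟨_, _, hp_low i, rfl, rfl⟩)
  have hmid : Relation.EqvGen (compRel q p hqp)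
      (.inl (.inr ⟨j, by omega⟩)) (.inl (.inr ⟨j + 1, by omega⟩)) := by
    refine .rel _ _ (.inr ⟨.inl ⟨j, by omega⟩, .inl ⟨j + 1, by omega⟩, ?_, rfl, rfl⟩)
    rw [g5]
    simp [label]
  have hq_eqv : ∀ x y : Fin q.k ⊕ Fin q.l, F (.inl x) = F (.inl y) →
      Relation.EqvGen (compRel q p hqp) (.inl x) (.inl y) := by
    have base : ∀ x y, label s t x = label s t y →
        Relation.EqvGen (compRel q p hqp) (.inl x) (.inl y) := fun x y hxy =>
      .rel _ _ (.inl ⟨x, y, (h5 x y).2 hxy, rfl, rfl⟩)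
    intro x y hxy
    simp only [F, Sum.elim_inl, merge] at hxy
    by_cases hx : label s t x = t (j + 1) <;> by_cases hy : label s t y = t (j + 1) <;>
      simp only [hx, hy, if_true, if_false] at hxy
    · exact base _ _ (hx.trans hy.symm)
    · exact (base x (.inr ⟨j + 1, by omega⟩) hx).trans _ _ _
        ((hmid.symm).trans _ _ _ (base (.inr ⟨j, by omega⟩) y hxy))
    · exact (base x (.inr ⟨j, by omega⟩) hxy).trans _ _ _
        (hmid.trans _ _ _ (base (.inr ⟨j + 1, by omega⟩) y hy.symm))
    · exact base _ _ hxy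
  have hF : ∀ x y, Relation.EqvGen (compRel q p hqp) x y ↔ F x = F y := by
    intro x y
    constructor
    · intro hxy
      induction hxy with
      | rel x y hxy =>
        rcases hxy with ⟨a, b, hab, rfl, rfl⟩ | ⟨a, b, hab, rfl, rfl⟩
        · rw [h5] at hab
          simp [F, hab]
        · rw [g5] at hab
          rcases a with a | a <;> rcases b with b | b <;>
            simp only [F, compEmbMid, label, Sum.elim_inl, Sum.elim_inr, Fin.val_cast] at hab ⊢ <;>
            grind [skip, merge]
      | refl x => rfl
      | symm x y _ ih => exact ih.symm
      | trans x y z _ _ ih ih' => exact ih.trans ih'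
    · intro hxy
      rcases x with x | x <;> rcases y with y | y
      · exact hq_eqv x y hxy
      · exact (hq_eqv x (.inr ⟨skip j y, hskip y⟩) hxy).trans _ _ _ (hlow y)
      · exact (hlow x).symm.trans _ _ _ (hq_eqv (.inr ⟨skip j x, hskip x⟩) y hxy)
      · exact (hlow x).symm.trans _ _ _ ((hq_eqv (.inr ⟨skip j x, hskip x⟩)
          (.inr ⟨skip j y, hskip y⟩) hxy).trans _ _ _ (hlow y))
  rintro (x | x) (y | y) <;> exact hF _ _

theorem HasModel.rotateUp {C : Set TCP} (hC : IsCategory C) {k l : ℕ}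
    {u d : ℕ → Color} {s t : ℕ → ℕ} (h : HasModel C k (l + 1) u d s t) :
    HasModel C (k + 1) l (splice 1 (fun _ => !d 0) u) (fun i => d (i + 1))
      (splice 1 (fun _ => t 0) s) (fun i => t (i + 1)) := by
  have h' := ((hasModel_idPart hC (!d 0)).tensor hC h).congr (k' := k + 1) (l' := l + 2)
    (by omega) (by omega) (fun _ _ => rfl) (fun _ _ => rfl) (fun _ _ _ _ => Iff.rfl)
    (fun _ _ _ _ => Iff.rfl) (fun _ _ _ _ => Iff.rfl)
  refine (h'.contract hC (j := 0) (by omega) (by simp [splice])).congr rfl rfl ?_ ?_ ?_ ?_ ?_ <;>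
    grind (splits := 20) [splice, merge, skip]

theorem HasModel.rotateDown {C : Set TCP} (hC : IsCategory C) {k l : ℕ}
    {u d : ℕ → Color} {s t : ℕ → ℕ} (h : HasModel C (k + 1) l u d s t) :
    HasModel C k (l + 1) (fun i => u (i + 1)) (splice 1 (fun _ => !u 0) d)
      (fun i => s (i + 1)) (splice 1 (fun _ => s 0) t) :=
  ((h.invol hC).rotateUp hC).invol hC

theorem HasModel.toLine {C : Set TCP} (hC : IsCategory C) {k l : ℕ}
    {u d : ℕ → Color} {s t : ℕ → ℕ} (h : HasModel C k l u d s t) :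
    HasModel C 0 (k + l) u (splice k (fun i => !u (k - 1 - i)) d) s
      (splice k (fun i => s (k - 1 - i)) t) := by
  induction k generalizing l u d s t with
  | zero =>
    refine h.congr rfl (by omega) ?_ ?_ ?_ ?_ ?_ <;> simp [splice]
  | succ k ih =>
    refine (ih (h.rotateDown hC)).congr rfl (by omega) ?_ ?_ ?_ ?_ ?_ <;> grind [splice]

/-- Moving the last lower point to the front. -/
theorem HasModel.cycle {C : Set TCP} (hC : IsCategory C) {l : ℕ}
    {u d : ℕ → Color} {s t : ℕ → ℕ} (h : HasModel C 0 (l + 1) u d s t) :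
    HasModel C 0 (l + 1) u (splice 1 (fun _ => d l) d) s (splice 1 (fun _ => t l) t) := by
  have h' := (h.tensor hC (hasModel_idPart hC (!d l))).congr (k' := 1) (l' := l + 2)
    (by omega) (by omega) (fun _ _ => rfl) (fun _ _ => rfl) (fun _ _ _ _ => Iff.rfl)
    (fun _ _ _ _ => Iff.rfl) (fun _ _ _ _ => Iff.rfl)
  refine ((h'.contract hC (j := l) le_rfl (by simp [splice])).rotateDown hC).congr
    rfl rfl ?_ ?_ ?_ ?_ ?_ <;> grind (splits := 20) [splice, merge, skip]

/-- The sign of a color: `1` for white and `-1` for black. -/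
def sign (c : Color) : ℤ := if c = white then 1 else -1

theorem sign_not (c : Color) : sign (!c) = -sign c := by
  cases c <;> simp [sign, white]

theorem card_white_sub_card_black {n : ℕ} (f : Fin n → Color) :
    (Nat.card {j // f j = white} : ℤ) - Nat.card {j // f j = black} = ∑ j, sign (f j) := by
  rw [Nat.card_eq_fintype_card, Nat.card_eq_fintype_card, Fintype.card_subtype,
    Fintype.card_subtype, Finset.card_filter, Finset.card_filter]
  push_cast
  rw [← Finset.sum_sub_distrib]
  refine Finset.sum_congr rfl fun j _ => ?_
  cases f j <;> simp [sign, white, black]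

theorem Models.cval_eq {p : TCP} {k l : ℕ} {u d : ℕ → Color} {s t : ℕ → ℕ}
    (h : Models p k l u d s t) :
    cval p = ∑ i ∈ Finset.range l, sign (d i) - ∑ i ∈ Finset.range k, sign (u i) := by
  obtain ⟨rfl, rfl, h3, h4, -⟩ := h
  have e1 := card_white_sub_card_black p.lowColor
  have e2 := card_white_sub_card_black p.upColor
  simp only [h3] at e2
  simp only [h4] at e1
  rw [Finset.sum_range, Finset.sum_range, ← e1, ← e2, cval]
  simp only [h3, h4]
  push_cast
  ring

/-- `C` contains a partition on a line consisting of `a` points, then `m` points whose first one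
is white, whose last one is black and in the same block as the first one, then `b` points, such
that no block meets both the middle part and its complement, and the signs of the complement sum
up to `n`. -/
def HasNest (C : Set TCP) (a m b : ℕ) (n : ℤ) : Prop :=
  ∃ (u d : ℕ → Color) (s t : ℕ → ℕ), HasModel C 0 (a + m + b) u d s t ∧
    d a = white ∧ d (a + m - 1) = black ∧ t a = t (a + m - 1) ∧
    (∀ i j, a ≤ i → i < a + m → j < a + m + b → j < a ∨ a + m ≤ j → t i ≠ t j) ∧
    ∑ i ∈ Finset.range a, sign (d i) + ∑ i ∈ Finset.range b, sign (d (a + m + i)) = n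

theorem exists_hasNest {C : Set TCP} {n : ℤ} (hn : n ∈ Kset C white black) :
    ∃ a m, 0 < a ∧ 2 ≤ m ∧ HasNest C a m 0 n := by
  obtain ⟨p₁, p₂, ⟨hmem, -, hk₁, hk₂, hpos, h2, hx, hy, hr⟩, rfl⟩ := hn
  obtain ⟨u, d, s, t, hm⟩ := exists_models p₁
  obtain ⟨u', d', s', t', hm'⟩ := exists_models p₂
  rw [hk₁] at hm
  rw [hk₂] at hm'
  refine ⟨p₁.l, p₂.l, hpos, h2, _, _, _, _, ⟨_, hmem, hm.tensor hm'⟩, ?_, ?_, ?_, ?_, ?_⟩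
  · rw [hm'.low] at hx
    simpa [splice] using hx
  · rw [hm'.low] at hy
    have : ¬ p₁.l + p₂.l - 1 < p₁.l := by omega
    simp only [splice, if_neg this]
    rw [← hy]
    congr 1
    simp only
    omega
  · rw [hm'.rel] at hr
    simp only [label, Sum.elim_inr] at hr
    grind [splice]
  · grind [splice]
  · rw [hm.cval_eq]
    simp only [Finset.range_zero, Finset.sum_empty, sub_zero, add_zero]
    refine Finset.sum_congr rfl fun i hi => ?_
    rw [splice, if_pos (Finset.mem_range.1 hi)]

theorem HasNest.mem_Kset {C : Set TCP} (hNC : ∀ p ∈ C, Noncrossing p) {a m : ℕ} {n : ℤ}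
    (ha : 0 < a) (hm : 2 ≤ m) (h : HasNest C a m 0 n) : n ∈ Kset C white black := by
  obtain ⟨u, d, s, t, ⟨p, hp, hmod⟩, h1, h2, h3, h4, h5⟩ := h
  let q : ℕ → ℕ → TCP := fun b l => mkLower l (fun j => d (b + j)) (fun j => t (b + j))
  have hq : ∀ b l, Models (q b l) 0 l u (fun j => d (b + j)) s (fun j => t (b + j)) := by
    refine fun b l => ⟨rfl, rfl, fun i => i.elim0, fun _ => rfl, ?_⟩
    rintro (x | x) (y | y)
    · exact x.elim0
    · exact x.elim0
    · exact y.elim0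
    · exact Iff.rfl
  have hpq : p = tensor (q 0 a) (q a m) := by
    refine hmod.unique (((hq 0 a).tensor (hq a m)).congr ?_ ?_ ?_ ?_ ?_) <;> grind [splice]
  refine ⟨q 0 a, q a m, ⟨hpq ▸ hp, hpq ▸ hNC p hp, rfl, rfl, ha, hm, h1, ?_, ?_⟩, ?_⟩
  · rw [(hq a m).low, ← h2]
    congr 1
    change a + (m - 1) = a + m - 1
    omega
  · rw [(hq a m).rel]
    change t (a + 0) = t (a + (m - 1))
    rw [show a + (m - 1) = a + m - 1 by omega, ← h3, add_zero]
  · rw [(hq 0 a).cval_eq, ← h5]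
    simp

theorem HasNest.reflect {C : Set TCP} (hC : IsCategory C) {a m : ℕ} {n : ℤ} (hm : 2 ≤ m)
    (h : HasNest C a m 0 n) : HasNest C 0 m a (-n) := by
  obtain ⟨u, d, s, t, hmod, h1, h2, h3, h4, h5⟩ := h
  refine ⟨d, fun i => !d (a + m - 1 - i), t, fun i => t (a + m - 1 - i),
    ((hmod.invol hC).toLine hC).congr rfl (by omega) ?_ ?_ ?_ ?_ ?_, ?_, ?_, ?_, ?_, ?_⟩
  any_goals grind [splice]
  · simp [h2, white, black]
  · simp only [show a + m - 1 - (0 + m - 1) = a by omega, h1]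
    rfl
  · rw [← h5, Finset.range_zero, Finset.sum_empty, Finset.sum_empty, zero_add, add_zero,
      ← Finset.sum_range_reflect, ← Finset.sum_neg_distrib]
    refine Finset.sum_congr rfl fun i hi => ?_
    have := Finset.mem_range.1 hi
    rw [sign_not, show a + m - 1 - (0 + m + (a - 1 - i)) = i by omega]

theorem HasNest.join {C : Set TCP} (hC : IsCategory C) {a m b m' : ℕ} {n n' : ℤ} (hm : 2 ≤ m)
    (hm' : 2 ≤ m') (h : HasNest C a m 0 n) (h' : HasNest C 0 m' b n') :
    HasNest C a (m + m' - 2) b (n + n') := by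
  obtain ⟨u, d, s, t, hmod, h1, h2, h3, h4, h5⟩ := h
  obtain ⟨u', d', s', t', hmod', h1', h2', h3', h4', h5'⟩ := h'
  have hten := (hmod.tensor hC hmod').congr (k' := 0) (l' := a + (m + m' - 2) + b + 2)
    rfl (by omega) (fun _ _ => rfl) (fun _ _ => rfl) (fun _ _ _ _ => Iff.rfl)
    (fun _ _ _ _ => Iff.rfl) (fun _ _ _ _ => Iff.rfl)
  have hcon := hten.contract hC (j := a + m - 1) (by omega) (by
    have e1 : ¬ a + m - 1 + 1 < a + m + 0 := by omega
    have e2 : a + m - 1 < a + m + 0 := by omega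
    have e3 : a + m - 1 + 1 - (a + m + 0) = 0 := by omega
    simp only [splice, if_neg e1, if_pos e2, e3, h1', h2]
    rfl)
  refine ⟨_, _, _, _, hcon, ?_, ?_, ?_, ?_, ?_⟩
  · grind [splice, skip]
  · grind [splice, skip]
  · grind [splice, skip, merge]
  · grind [splice, skip, merge]
  · rw [← h5, ← h5']
    simp only [Finset.range_zero, Finset.sum_empty, zero_add, add_zero]
    congr 1
    · refine Finset.sum_congr rfl fun i hi => ?_
      have := Finset.mem_range.1 hi
      congr 1
      grind [splice, skip]
    · refine Finset.sum_congr rfl fun i hi => ?_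
      congr 1
      grind [splice, skip]

theorem HasNest.cycle {C : Set TCP} (hC : IsCategory C) {a m b : ℕ} {n : ℤ} (hm : 2 ≤ m)
    (h : HasNest C a m (b + 1) n) : HasNest C (a + 1) m b n := by
  obtain ⟨u, d, s, t, hmod, h1, h2, h3, h4, h5⟩ := h
  refine ⟨u, splice 1 (fun _ => d (a + m + b)) d, s, splice 1 (fun _ => t (a + m + b)) t,
    (HasModel.cycle hC (l := a + m + b) hmod).congr rfl (by omega) ?_ ?_ ?_ ?_ ?_,
    ?_, ?_, ?_, ?_, ?_⟩
  any_goals grind [splice]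
  rw [← h5, Finset.sum_range_succ', Finset.sum_range_succ _ b]
  have : ∀ i, splice 1 (fun _ => d (a + m + b)) d (a + 1 + m + i) = d (a + m + i) := by
    grind [splice]
  simp only [this]
  simp only [splice, add_lt_iff_neg_right, not_lt_zero, if_false, add_tsub_cancel_right,
    zero_lt_one, if_true]
  ring

theorem HasNest.cycle_all {C : Set TCP} (hC : IsCategory C) {a m b : ℕ} {n : ℤ} (hm : 2 ≤ m)
    (h : HasNest C a m b n) : HasNest C (a + b) m 0 n := by
  induction b generalizing a with
  | zero => exact h
  | succ b ih =>
    have := ih (h.cycle hC hm)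
    rwa [show a + 1 + b = a + (b + 1) by omega] at this

theorem sub_mem_Kset {C : Set TCP} (hC : IsCategory C) (hNC : ∀ p ∈ C, Noncrossing p)
    {n n' : ℤ} (h : n ∈ Kset C white black) (h' : n' ∈ Kset C white black) :
    n - n' ∈ Kset C white black := by
  obtain ⟨a, m, ha, hm, h⟩ := exists_hasNest h
  obtain ⟨a', m', ha', hm', h'⟩ := exists_hasNest h'
  rw [sub_eq_add_neg]
  exact ((h.join hC hm hm' (h'.reflect hC hm')).cycle_all hC (by omega)).mem_Kset hNC
    (by omega) (by omega)

theorem cval_mem_Kset {C : Set TCP} (hC : IsCategory C) (hNC : ∀ p ∈ C, Noncrossing p)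
    {p : TCP} (hp : p ∈ C) (hk : p.k = 0) (hl : 0 < p.l) : cval p ∈ Kset C white black := by
  have h := hC.tensor_mem _ hp _ hC.pairwb_mem
  exact ⟨p, pairLower white black,
    ⟨h, hNC _ h, hk, rfl, hl, le_rfl, rfl, rfl, rfl⟩, rfl⟩

theorem exists_cval_eq_of_mem {C : Set TCP} (hC : IsCategory C) {p : TCP} (hp : p ∈ C) :
    ∃ q ∈ C, q.k = 0 ∧ cval q = cval p := by
  obtain ⟨u, d, s, t, hm⟩ := exists_models p
  obtain ⟨q, hq, hqm⟩ := HasModel.toLine hC ⟨p, hp, hm⟩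
  refine ⟨q, hq, hqm.hk, ?_⟩
  rw [hqm.cval_eq, hm.cval_eq, Finset.sum_range_add, Finset.range_zero, Finset.sum_empty, sub_zero,
    add_comm, sub_eq_add_neg]
  congr 1
  · exact Finset.sum_congr rfl fun i _ => by simp [splice]
  · rw [← Finset.sum_neg_distrib, ← Finset.sum_range_reflect]
    refine Finset.sum_congr rfl fun i hi => ?_
    have := Finset.mem_range.1 hi
    simp only [splice]
    rw [if_pos (by omega), sign_not]
    congr 3
    omega

theorem mem_Kset_of_cval_ne_zero {C : Set TCP} (hC : IsCategory C)
    (hNC : ∀ p ∈ C, Noncrossing p) {p : TCP} (hp : p ∈ C) (h0 : cval p ≠ 0) :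
    cval p ∈ Kset C white black := by
  obtain ⟨q, hq, hk, hc⟩ := exists_cval_eq_of_mem hC hp
  rw [← hc] at h0 ⊢
  refine cval_mem_Kset hC hNC hq hk (Nat.pos_of_ne_zero fun hl => h0 ?_)
  obtain ⟨u, d, s, t, hm⟩ := exists_models q
  rw [hm.cval_eq, hk, hl]
  simp

theorem zero_mem_Kset {C : Set TCP} (hC : IsCategory C) (hNC : ∀ p ∈ C, Noncrossing p) :
    (0 : ℤ) ∈ Kset C white black := by
  have h := cval_mem_Kset hC hNC hC.pairwb_mem rfl two_pos
  simpa using sub_mem_Kset hC hNC h h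

/-- The set `K^C(∘,•)` as a subgroup of the integers. -/
def KsetSubgroup {C : Set TCP} (hC : IsCategory C) (hNC : ∀ p ∈ C, Noncrossing p) :
    AddSubgroup ℤ :=
  AddSubgroup.ofSub (Kset C white black) ⟨0, zero_mem_Kset hC hNC⟩
    fun _ hx _ hy => by simpa [sub_eq_add_neg] using sub_mem_Kset hC hNC hx hy

/-- A subgroup of the integers consists of the multiples of its least positive element. -/
theorem addSubgroup_int_eq_multiples (H : AddSubgroup ℤ) :
    (H : Set ℤ) = {n : ℤ | ((sInf {n : ℕ | 0 < n ∧ (n : ℤ) ∈ H} : ℕ) : ℤ) ∣ n} := by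
  set S := {n : ℕ | 0 < n ∧ (n : ℤ) ∈ H} with hS
  have hdiv : ∀ n ∈ H, ((sInf S : ℕ) : ℤ) ∣ n := by
    intro n hn
    rcases S.eq_empty_or_nonempty with he | hne
    · rw [he, Nat.sInf_empty]
      by_contra h
      have h0 : n ≠ 0 := fun h' => h (by simp [h'])
      have : n.natAbs ∈ S := ⟨Int.natAbs_pos.2 h0, by
        rcases Int.natAbs_eq n with h' | h'
        · rwa [← h']
        · rw [show ((n.natAbs : ℕ) : ℤ) = -n by omega]; exact H.neg_mem hn⟩
      rw [he] at this
      exact this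
    · obtain ⟨hpos, hmem⟩ := Nat.sInf_mem hne
      have hr : n % (sInf S : ℕ) ∈ H := by
        rw [Int.emod_def]
        refine H.sub_mem hn ?_
        rw [mul_comm, ← smul_eq_mul]
        exact H.zsmul_mem hmem _
      have hp : (0 : ℤ) < (sInf S : ℕ) := by exact_mod_cast hpos
      have h1 := Int.emod_nonneg n hp.ne'
      have h2 := Int.emod_lt_of_pos n hp
      refine Int.dvd_of_emod_eq_zero ?_
      by_contra h
      have h3 : (n % (sInf S : ℕ)).toNat ∈ S := ⟨by omega, by rwa [Int.toNat_of_nonneg h1]⟩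
      have := Nat.sInf_le h3
      omega
  refine Set.Subset.antisymm (fun n hn => hdiv n hn) ?_
  rintro n ⟨m, rfl⟩
  have hmem : ((sInf S : ℕ) : ℤ) ∈ H := by
    rcases S.eq_empty_or_nonempty with he | hne
    · rw [he, Nat.sInf_empty]
      exact H.zero_mem
    · exact (Nat.sInf_mem hne).2
  rw [mul_comm, ← smul_eq_mul]
  exact H.zsmul_mem hmem _

/-- `K^C(∘,•) = d(C)·ℤ`, and if `k(C) ≠ 0` then `d(C) ≠ 0` and `d(C)` divides `k(C)`. -/
theorem stmt_6 (C : Set TCP) (hC : IsCategory C) (hNC : ∀ p ∈ C, Noncrossing p) :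
    Kset C white black = {n : ℤ | (ddeg C : ℤ) ∣ n} ∧
    (kdeg C ≠ 0 → ddeg C ≠ 0 ∧ ddeg C ∣ kdeg C) := by
  have hK : Kset C white black = {n : ℤ | (ddeg C : ℤ) ∣ n} :=
    addSubgroup_int_eq_multiples (KsetSubgroup hC hNC)
  refine ⟨hK, fun hk => ?_⟩
  have hne := Nat.nonempty_of_sInf_eq_succ (Nat.succ_pred_eq_of_ne_zero hk).symm
  obtain ⟨hpos, p, hp, hcp⟩ : 0 < kdeg C ∧ ∃ p ∈ C, cval p = (kdeg C : ℤ) := Nat.sInf_mem hne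
  have hmem := mem_Kset_of_cval_ne_zero hC hNC hp (by rw [hcp]; exact_mod_cast hk)
  rw [hcp, hK] at hmem
  have hdvd : ddeg C ∣ kdeg C := Int.natCast_dvd_natCast.1 hmem
  exact ⟨fun h => hk (Nat.eq_zero_of_zero_dvd (h ▸ hdvd)), hdvd⟩

end CTCP
end
end
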